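/- For every n-dimensional convex body K ⊂ ℝ^n, V_n(K) ≤ ∫₀¹ V_n((1−t)K − tK) dt ≤ (2^n/(n+1)) V_n(K). Equality holds on the left if and only if K is centrally symmetric, and on the right if and only if K is an n-simplex. -/

import Mathlib

open MeasureTheory
open scoped Pointwise ENNReal

noncomputable section

theorem Real.volume_add_le_volume_add_of_isCompact {A B : Set ℝ} (hA : IsCompact A)
    (hB : IsCompact B) (hA' : A.Nonempty) (hB' : B.Nonempty) :
    volume A + volume B ≤ volume (A + B) := by
  obtain ⟨a, haA, ha⟩ := hA.exists_isGreatest hA'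
  obtain ⟨b, hbB, hb⟩ := hB.exists_isLeast hB'
  have h1 : volume A = volume (b +ᵥ A) := (measure_vadd volume b A).symm
  have h2 : volume B = volume (a +ᵥ B) := (measure_vadd volume a B).symm
  have hdisj : AEDisjoint volume (b +ᵥ A) (a +ᵥ B) := by
    refine measure_mono_null (t := {a + b}) ?_ (by simp)
    rintro x ⟨⟨y, hy, rfl⟩, ⟨z, hz, hzx⟩⟩
    have hy' := ha hy
    have hz' := hb hz
    simp only [vadd_eq_add] at hzx ⊢
    rw [Set.mem_singleton_iff]
    linarith
  rw [h1, h2, ← measure_union₀ (hB.vadd a).measurableSet.nullMeasurableSet hdisj]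
  refine measure_mono (Set.union_subset ?_ ?_)
  · rintro _ ⟨x, hx, rfl⟩
    exact ⟨x, hx, b, hbB, by simp [add_comm]⟩
  · rintro _ ⟨x, hx, rfl⟩
    exact ⟨a, haA, x, hx, by simp⟩

theorem Real.volume_combo_le {A B C : Set ℝ} (hA : MeasurableSet A) (hB : MeasurableSet B)
    (hA' : A.Nonempty) (hB' : B.Nonempty) {t : ℝ} (ht0 : 0 ≤ t) (ht1 : t ≤ 1)
    (hC : (1 - t) • A + t • B ⊆ C) :
    ENNReal.ofReal (1 - t) * volume A + ENNReal.ofReal t * volume B ≤ volume C := by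
  obtain ⟨a, ha⟩ := hA'
  obtain ⟨b, hb⟩ := hB'
  have key : ∀ A', A' ⊆ A ∧ IsCompact A' → ∀ B', B' ⊆ B ∧ IsCompact B' →
      ENNReal.ofReal (1 - t) * volume A' + ENNReal.ofReal t * volume B' ≤ volume C := by
    rintro A' ⟨hA'A, hA'⟩ B' ⟨hB'B, hB'⟩
    have hA'' : IsCompact (insert a A') := hA'.insert a
    have hB'' : IsCompact (insert b B') := hB'.insert b
    have := Real.volume_add_le_volume_add_of_isCompact (hA''.smul (1 - t)) (hB''.smul t)
      (Set.insert_nonempty _ _).smul_set (Set.insert_nonempty _ _).smul_set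
    rw [Measure.addHaar_smul, Measure.addHaar_smul] at this
    simp only [Module.finrank_self, pow_one, abs_of_nonneg ht0, abs_of_nonneg (sub_nonneg.2 ht1)]
      at this
    refine le_trans ?_ (this.trans (measure_mono (le_trans ?_ hC)))
    · gcongr <;> exact Set.subset_insert _ _
    · exact Set.add_subset_add (Set.smul_set_mono (Set.insert_subset ha hA'A))
        (Set.smul_set_mono (Set.insert_subset hb hB'B))
  rw [hA.measure_eq_iSup_isCompact volume, hB.measure_eq_iSup_isCompact volume]
  simp only [ENNReal.mul_iSup]
  simp only [iSup_and']
  exact ENNReal.biSup_add_biSup_le' ⟨∅, by simp⟩ ⟨∅, by simp⟩ key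

theorem lintegral_eq_lintegral_meas_ofReal_lt {α : Type*} [MeasurableSpace α] (μ : Measure α)
    {F : α → ℝ≥0∞} (hF : Measurable F) (hF' : ∀ x, F x ≠ ∞) :
    ∫⁻ x, F x ∂μ = ∫⁻ s in Set.Ioi (0 : ℝ), μ {x | ENNReal.ofReal s < F x} := by
  have := lintegral_eq_lintegral_meas_lt (f := fun x => (F x).toReal) μ
    (ae_of_all _ fun x => ENNReal.toReal_nonneg) hF.ennreal_toReal.aemeasurable
  simp only [ENNReal.ofReal_toReal (hF' _)] at this
  rw [this]
  refine setLIntegral_congr_fun measurableSet_Ioi fun s hs => ?_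
  congr 1
  ext x
  exact (ENNReal.ofReal_lt_iff_lt_toReal (le_of_lt hs) (hF' x)).symm

theorem lintegral_combo_le_of_iSup_eq_one {t : ℝ} (ht0 : 0 < t) (ht1 : t < 1) {f g h : ℝ → ℝ≥0∞}
    (hf : Measurable f) (hg : Measurable g) (hh : Measurable h) (hf1 : ⨆ x, f x = 1)
    (hg1 : ⨆ x, g x = 1)
    (H : ∀ x y, f x ^ (1 - t) * g y ^ t ≤ h ((1 - t) • x + t • y)) :
    ENNReal.ofReal (1 - t) * (∫⁻ x, f x) + ENNReal.ofReal t * (∫⁻ x, g x) ≤ ∫⁻ x, h x := by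
  have hf1' : ∀ x, f x ≤ 1 := fun x => hf1 ▸ le_iSup f x
  have hg1' : ∀ x, g x ≤ 1 := fun x => hg1 ▸ le_iSup g x
  have hle : ∫⁻ x, min (h x) 1 ≤ ∫⁻ x, h x := lintegral_mono fun x => min_le_left _ _
  refine le_trans ?_ hle
  rw [lintegral_eq_lintegral_meas_ofReal_lt volume hf fun x => ne_top_of_le_ne_top (by simp) (hf1' x),
    lintegral_eq_lintegral_meas_ofReal_lt volume hg fun x => ne_top_of_le_ne_top (by simp) (hg1' x),
    lintegral_eq_lintegral_meas_ofReal_lt volume (hh.min measurable_const)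
      fun x => ne_top_of_le_ne_top (by simp) (min_le_right _ _)]
  refine (add_le_add (lintegral_const_mul_le _ _) (lintegral_const_mul_le _ _)).trans
    ((le_lintegral_add _ _).trans ?_)
  refine setLIntegral_mono' measurableSet_Ioi fun s hs => ?_
  rcases lt_or_ge s 1 with hs1 | hs1
  · have hs1' : ENNReal.ofReal s < 1 := by simpa using hs1
    obtain ⟨x₀, hx₀⟩ := lt_iSup_iff.1 (hs1'.trans_eq hf1.symm)
    obtain ⟨y₀, hy₀⟩ := lt_iSup_iff.1 (hs1'.trans_eq hg1.symm)
    apply Real.volume_combo_le (measurableSet_lt measurable_const hf)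
      (measurableSet_lt measurable_const hg) ⟨x₀, hx₀⟩ ⟨y₀, hy₀⟩ ht0.le ht1.le
    rintro _ ⟨_, ⟨x, hx, rfl⟩, _, ⟨y, hy, rfl⟩, rfl⟩
    refine lt_min (lt_of_lt_of_le ?_ (H x y)) hs1'
    have hs0 : ENNReal.ofReal s ≠ 0 := by simpa using hs
    calc ENNReal.ofReal s = ENNReal.ofReal s ^ (1 - t) * ENNReal.ofReal s ^ t := by
          rw [← ENNReal.rpow_add _ _ hs0 ENNReal.ofReal_ne_top]; simp
      _ < f x ^ (1 - t) * g y ^ t :=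
        ENNReal.mul_lt_mul (ENNReal.rpow_lt_rpow hx (by linarith)) (ENNReal.rpow_lt_rpow hy ht0)
  · have hs1' : 1 ≤ ENNReal.ofReal s := by simpa using hs1
    have e1 : {x | ENNReal.ofReal s < f x} = ∅ :=
      Set.eq_empty_of_forall_notMem fun x hx => absurd ((hf1' x).trans hs1') (not_le.2 hx)
    have e2 : {x | ENNReal.ofReal s < g x} = ∅ :=
      Set.eq_empty_of_forall_notMem fun x hx => absurd ((hg1' x).trans hs1') (not_le.2 hx)
    simp [e1, e2]

theorem ENNReal.rpow_mul_rpow_le_weighted_add {t : ℝ} (ht0 : 0 < t) (ht1 : t < 1) (x y : ℝ≥0∞) :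
    x ^ (1 - t) * y ^ t ≤ ENNReal.ofReal (1 - t) * x + ENNReal.ofReal t * y := by
  have ht1' : 0 < 1 - t := sub_pos.2 ht1
  rcases eq_or_ne x ∞ with rfl | hx
  · rw [ENNReal.mul_top (by simpa using ht1)]; simp
  rcases eq_or_ne y ∞ with rfl | hy
  · rw [ENNReal.mul_top (by simpa using ht0)]; simp
  lift x to NNReal using hx
  lift y to NNReal using hy
  have := NNReal.geom_mean_le_arith_mean2_weighted (Real.toNNReal (1 - t)) (Real.toNNReal t) x y
    (by rw [← Real.toNNReal_add ht1'.le ht0.le]; simp)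
  rw [Real.coe_toNNReal _ ht1'.le, Real.coe_toNNReal _ ht0.le] at this
  rw [← ENNReal.coe_rpow_of_nonneg _ ht1'.le, ← ENNReal.coe_rpow_of_nonneg _ ht0.le]
  unfold ENNReal.ofReal
  exact_mod_cast this

/-- The Prékopa–Leindler inequality holds for the measure `μ`. -/
def PrekopaLeindler {E : Type*} [AddCommGroup E] [Module ℝ E] [MeasurableSpace E]
    (μ : Measure E) : Prop :=
  ∀ ⦃t : ℝ⦄, 0 < t → t < 1 → ∀ ⦃f g h : E → ℝ≥0∞⦄, Measurable f → Measurable g → Measurable h →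
    (∀ x y, f x ^ (1 - t) * g y ^ t ≤ h ((1 - t) • x + t • y)) →
    (∫⁻ x, f x ∂μ) ^ (1 - t) * (∫⁻ x, g x ∂μ) ^ t ≤ ∫⁻ x, h x ∂μ

theorem lintegral_rpow_mul_le_of_iSup_ne_top {t : ℝ} (ht0 : 0 < t) (ht1 : t < 1)
    {f g h : ℝ → ℝ≥0∞}
    (hf : Measurable f) (hg : Measurable g) (hh : Measurable h) (hf1 : ⨆ x, f x ≠ ∞)
    (hg1 : ⨆ x, g x ≠ ∞)
    (H : ∀ x y, f x ^ (1 - t) * g y ^ t ≤ h ((1 - t) • x + t • y)) :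
    (∫⁻ x, f x) ^ (1 - t) * (∫⁻ x, g x) ^ t ≤ ∫⁻ x, h x := by
  have ht1' : 0 < 1 - t := sub_pos.2 ht1
  rcases eq_or_ne (⨆ x, f x) 0 with hf0 | hf0
  · have : ∀ x, f x = 0 := by simpa using hf0
    simp [this, ht1']
  rcases eq_or_ne (⨆ x, g x) 0 with hg0 | hg0
  · have : ∀ x, g x = 0 := by simpa using hg0
    simp [this, ht0]
  set a := ⨆ x, f x
  set b := ⨆ x, g x
  have ha' : a⁻¹ ≠ ∞ := ENNReal.inv_ne_top.2 hf0
  have hb' : b⁻¹ ≠ ∞ := ENNReal.inv_ne_top.2 hg0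
  have key := lintegral_combo_le_of_iSup_eq_one (f := fun x => a⁻¹ * f x) (g := fun x => b⁻¹ * g x)
    (h := fun x => ((a⁻¹) ^ (1 - t) * (b⁻¹) ^ t) * h x) ht0 ht1 (hf.const_mul _) (hg.const_mul _)
    (hh.const_mul _) (by rw [← ENNReal.mul_iSup, ENNReal.inv_mul_cancel hf0 hf1])
    (by rw [← ENNReal.mul_iSup, ENNReal.inv_mul_cancel hg0 hg1]) fun x y => by
      rw [ENNReal.mul_rpow_of_nonneg _ _ ht1'.le, ENNReal.mul_rpow_of_nonneg _ _ ht0.le,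
        mul_mul_mul_comm]
      gcongr
      exact H x y
  replace key := (ENNReal.rpow_mul_rpow_le_weighted_add ht0 ht1 _ _).trans key
  rw [lintegral_const_mul _ hf, lintegral_const_mul _ hg, lintegral_const_mul _ hh,
    ENNReal.mul_rpow_of_nonneg _ _ ht1'.le, ENNReal.mul_rpow_of_nonneg _ _ ht0.le,
    mul_mul_mul_comm] at key
  refine (ENNReal.mul_le_mul_iff_right (mul_ne_zero ?_ ?_) (ENNReal.mul_ne_top ?_ ?_)).1 key
  · simp [ENNReal.rpow_eq_zero_iff, hf1, ha', ht1]
  · simp [ENNReal.rpow_eq_zero_iff, hg1, hb']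
  · exact ENNReal.rpow_ne_top_of_nonneg ht1'.le ha'
  · exact ENNReal.rpow_ne_top_of_nonneg ht0.le hb'

theorem prekopaLeindler_real : PrekopaLeindler (volume : Measure ℝ) := by
  intro t ht0 ht1 f g h hf hg hh H
  have ht1' : 0 < 1 - t := sub_pos.2 ht1
  have hlim : ∀ {F : ℝ → ℝ≥0∞}, Measurable F →
      Filter.Tendsto (fun k : ℕ => ∫⁻ x, min (F x) k) Filter.atTop (nhds (∫⁻ x, F x)) := by
    intro F hF
    refine lintegral_tendsto_of_tendsto_of_monotone
      (fun k => (hF.min measurable_const).aemeasurable) (ae_of_all _ fun x i j hij => ?_)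
      (ae_of_all _ fun x => ?_)
    · exact min_le_min le_rfl (by exact_mod_cast hij)
    · simpa using tendsto_const_nhds.min ENNReal.tendsto_nat_nhds_top
  have hk : ∀ k : ℕ, (∫⁻ x, min (f x) k) ^ (1 - t) * (∫⁻ x, min (g x) k) ^ t ≤ ∫⁻ x, h x := by
    intro k
    refine lintegral_rpow_mul_le_of_iSup_ne_top ht0 ht1 (hf.min measurable_const)
      (hg.min measurable_const) hh ?_ ?_ fun x y => le_trans ?_ (H x y)
    · exact ne_top_of_le_ne_top (ENNReal.natCast_ne_top k) (iSup_le fun x => min_le_right _ _)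
    · exact ne_top_of_le_ne_top (ENNReal.natCast_ne_top k) (iSup_le fun x => min_le_right _ _)
    · gcongr <;> exact min_le_left _ _
  rcases eq_or_ne (∫⁻ x, f x) 0 with hf0 | hf0
  · simp [hf0, ht1']
  rcases eq_or_ne (∫⁻ x, g x) 0 with hg0 | hg0
  · simp [hg0, ht0]
  refine le_of_tendsto' (ENNReal.Tendsto.mul ((hlim hf).ennrpow_const _) ?_
    ((hlim hg).ennrpow_const _) ?_) hk
  · left; simp [ENNReal.rpow_eq_zero_iff, hf0, ht1.le]
  · left; simp [ENNReal.rpow_eq_zero_iff, hg0, ht0.le]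

theorem PrekopaLeindler.prod {E F : Type*} [AddCommGroup E] [Module ℝ E] [MeasurableSpace E]
    [AddCommGroup F] [Module ℝ F] [MeasurableSpace F] {μ : Measure E} {ν : Measure F}
    [SFinite μ] [SFinite ν] (hμ : PrekopaLeindler μ) (hν : PrekopaLeindler ν) :
    PrekopaLeindler (μ.prod ν) := by
  intro t ht0 ht1 f g h hf hg hh H
  rw [lintegral_prod _ hf.aemeasurable, lintegral_prod _ hg.aemeasurable,
    lintegral_prod _ hh.aemeasurable]
  refine hμ ht0 ht1 hf.lintegral_prod_right' hg.lintegral_prod_right' hh.lintegral_prod_right'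
    fun x y => ?_
  exact hν ht0 ht1 (hf.comp measurable_prodMk_left) (hg.comp measurable_prodMk_left)
    (hh.comp measurable_prodMk_left) fun x' y' => H (x, x') (y, y')

theorem PrekopaLeindler.of_measurePreserving {E F : Type*} [AddCommGroup E] [Module ℝ E]
    [MeasurableSpace E] [AddCommGroup F] [Module ℝ F] [MeasurableSpace F] {μ : Measure E}
    {ν : Measure F} (hμ : PrekopaLeindler μ) (e : E →ₗ[ℝ] F) (he : MeasurePreserving e μ ν) :
    PrekopaLeindler ν := by
  intro t ht0 ht1 f g h hf hg hh H
  rw [← he.lintegral_comp hf, ← he.lintegral_comp hg, ← he.lintegral_comp hh]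
  refine hμ ht0 ht1 (hf.comp he.measurable) (hg.comp he.measurable) (hh.comp he.measurable)
    fun x y => ?_
  simpa using H (e x) (e y)

theorem prekopaLeindler_pi (n : ℕ) : PrekopaLeindler (volume : Measure (Fin n → ℝ)) := by
  induction n with
  | zero =>
    intro t ht0 ht1 f g h hf hg hh H
    rw [volume_pi, Measure.pi_of_empty _ default]
    rw [lintegral_dirac' _ hf, lintegral_dirac' _ hg, lintegral_dirac' _ hh]
    exact (H default default).trans_eq (congrArg h (Subsingleton.elim _ _))
  | succ n ih =>
    let e : (ℝ × (Fin n → ℝ)) →ₗ[ℝ] (Fin (n + 1) → ℝ) :=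
      { toFun := fun p => Fin.cons p.1 p.2
        map_add' := fun p q => by ext i; refine Fin.cases ?_ (fun j => ?_) i <;> simp
        map_smul' := fun c p => by ext i; refine Fin.cases ?_ (fun j => ?_) i <;> simp }
    refine (prekopaLeindler_real.prod ih).of_measurePreserving e ?_
    have h := (volume_preserving_piFinSuccAbove (fun _ : Fin (n + 1) => ℝ) 0).symm
    have he : ⇑e = (MeasurableEquiv.piFinSuccAbove (fun _ : Fin (n + 1) => ℝ) 0).symm := by
      ext p i
      refine Fin.cases ?_ (fun j => ?_) i <;> simp [e, MeasurableEquiv.piFinSuccAbove]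
    rw [he]
    exact h

theorem prekopaLeindler_euclideanSpace (n : ℕ) :
    PrekopaLeindler (volume : Measure (EuclideanSpace ℝ (Fin n))) :=
  (prekopaLeindler_pi n).of_measurePreserving
    (WithLp.linearEquiv 2 ℝ (Fin n → ℝ)).symm.toLinearMap
    (EuclideanSpace.volume_preserving_symm_measurableEquiv_toLp (Fin n)).symm

theorem subset_of_measure_le {E : Type*} [NormedAddCommGroup E] [NormedSpace ℝ E]
    [MeasurableSpace E] [BorelSpace E] {μ : Measure E} [μ.IsOpenPosMeasure] {A B : Set E}
    (hA : IsClosed A) (hB : Convex ℝ B) (hB' : (interior B).Nonempty) (hAB : A ⊆ B)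
    (hle : μ B ≤ μ A) (hfin : μ A ≠ ∞) : B ⊆ A := by
  have h0 : μ (interior B \ A) = 0 := by
    refine measure_mono_null (Set.sdiff_subset_sdiff_left interior_subset) ?_
    rw [measure_sdiff hAB hA.measurableSet.nullMeasurableSet hfin]
    exact tsub_eq_zero_of_le hle
  rw [(isOpen_interior.sdiff hA).measure_eq_zero_iff μ, Set.sdiff_eq_empty] at h0
  refine subset_closure.trans ?_
  rw [← hB.closure_interior_eq_closure_of_nonempty_interior hB']
  exact hA.closure_subset_iff.2 h0

theorem PrekopaLeindler.setIntegral_le {E : Type*} [NormedAddCommGroup E] [NormedSpace ℝ E]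
    [MeasurableSpace E] [BorelSpace E] {μ : Measure E} [IsFiniteMeasureOnCompacts μ]
    (hμ : PrekopaLeindler μ) {t : ℝ} (ht0 : 0 < t) (ht1 : t < 1) {K L T : Set E}
    (hK : IsCompact K) (hL : IsCompact L) (hT : IsCompact T) {F G H : E → ℝ}
    (hF : Continuous F) (hG : Continuous G) (hH : Continuous H) (hF0 : ∀ x ∈ K, 0 ≤ F x)
    (hG0 : ∀ x ∈ L, 0 ≤ G x) (hH0 : ∀ x ∈ T, 0 ≤ H x)
    (h : ∀ x ∈ K, ∀ y ∈ L, (1 - t) • x + t • y ∈ T ∧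
      F x ^ (1 - t) * G y ^ t ≤ H ((1 - t) • x + t • y))
    (hFG : ∫ x in K, F x ∂μ = ∫ x in L, G x ∂μ) :
    ∫ x in K, F x ∂μ ≤ ∫ x in T, H x ∂μ := by
  have ht1' : 0 < 1 - t := sub_pos.2 ht1
  have key : ∀ {A : Set E} {u : E → ℝ}, IsCompact A → Continuous u → (∀ x ∈ A, 0 ≤ u x) →
      ∫⁻ x, A.indicator (fun x => ENNReal.ofReal (u x)) x ∂μ =
        ENNReal.ofReal (∫ x in A, u x ∂μ) := by
    intro A u hA hu hu0
    rw [lintegral_indicator hA.measurableSet, ofReal_integral_eq_lintegral_ofReal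
      (hu.continuousOn.integrableOn_compact hA)
      ((ae_restrict_iff' hA.measurableSet).2 (ae_of_all _ hu0))]
  have hmeas : ∀ {A : Set E} {u : E → ℝ}, IsCompact A → Continuous u →
      Measurable (A.indicator (fun x => ENNReal.ofReal (u x))) := fun hA hu =>
    hu.measurable.ennreal_ofReal.indicator hA.measurableSet
  have := hμ ht0 ht1 (hmeas hK hF) (hmeas hL hG) (hmeas hT hH) fun x y => by
    by_cases hx : x ∈ K
    · by_cases hy : y ∈ L
      · obtain ⟨h1, h2⟩ := h x hx y hy
        rw [Set.indicator_of_mem hx, Set.indicator_of_mem hy, Set.indicator_of_mem h1,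
          ENNReal.ofReal_rpow_of_nonneg (hF0 x hx) ht1'.le,
          ENNReal.ofReal_rpow_of_nonneg (hG0 y hy) ht0.le,
          ← ENNReal.ofReal_mul (Real.rpow_nonneg (hF0 x hx) _)]
        exact ENNReal.ofReal_le_ofReal h2
      · simp [Set.indicator_of_notMem hy, ht0]
    · simp [Set.indicator_of_notMem hx, ht1']
  rw [key hK hF hF0, key hL hG hG0, key hT hH hH0, ← hFG] at this
  have hI : 0 ≤ ∫ x in K, F x ∂μ := setIntegral_nonneg hK.measurableSet hF0
  have hJ : 0 ≤ ∫ x in T, H x ∂μ := setIntegral_nonneg hT.measurableSet hH0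
  rcases hI.eq_or_lt with h0 | hI
  · rwa [← h0]
  rw [← ENNReal.rpow_add _ _ (by simpa using hI) ENNReal.ofReal_ne_top, sub_add_cancel,
    ENNReal.rpow_one] at this
  exact (ENNReal.ofReal_le_ofReal_iff hJ).1 this

theorem setIntegral_neg_set {E : Type*} [NormedAddCommGroup E] [MeasurableSpace E] [BorelSpace E]
    {μ : Measure E} [μ.IsNegInvariant] {F : Type*} [NormedAddCommGroup F] [NormedSpace ℝ F]
    (K : Set E) (f : E → F) : ∫ x in -K, f x ∂μ = ∫ x in K, f (-x) ∂μ := by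
  have := (Measure.measurePreserving_neg μ).setIntegral_preimage_emb
    (MeasurableEquiv.neg E).measurableEmbedding (fun x => f (-x)) K
  simpa using this

theorem isCompact_combo_neg {E : Type*} [NormedAddCommGroup E] [NormedSpace ℝ E] {K : Set E}
    (hK : IsCompact K) (t : ℝ) : IsCompact ((1 - t) • K + t • (-K)) :=
  (hK.smul _).add (hK.neg.smul _)

section
variable {E : Type*} [NormedAddCommGroup E] [NormedSpace ℝ E] [MeasurableSpace E] [BorelSpace E]
  [FiniteDimensional ℝ E] {μ : Measure E} [μ.IsAddHaarMeasure] {K : Set E}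

theorem PrekopaLeindler.measure_le_measure_combo_neg (hμ : PrekopaLeindler μ) (hK : IsCompact K)
    (hKne : K.Nonempty) {t : ℝ} (ht : t ∈ Set.Icc (0 : ℝ) 1) :
    μ K ≤ μ ((1 - t) • K + t • (-K)) := by
  rcases ht.1.eq_or_lt with rfl | ht0
  · simp [Set.zero_smul_set hKne.neg]
  rcases ht.2.eq_or_lt with rfl | ht1
  · simp [Set.zero_smul_set hKne]
  have hT := isCompact_combo_neg hK t
  have := hμ.setIntegral_le ht0 ht1 hK hK.neg hT
    (continuous_const (y := (1 : ℝ))) (continuous_const (y := (1 : ℝ)))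
    (continuous_const (y := (1 : ℝ)))
    (by simp) (by simp) (by simp) (fun x hx y hy =>
      ⟨Set.add_mem_add (Set.smul_mem_smul_set hx) (Set.smul_mem_smul_set hy), by simp⟩)
    (by simp [Measure.real])
  simp only [setIntegral_const, smul_eq_mul, mul_one] at this
  exact (ENNReal.toReal_le_toReal hK.measure_ne_top hT.measure_ne_top).1 this

theorem measure_half_combo_neg_le (hK : Convex ℝ K) (hKne : K.Nonempty) {t : ℝ}
    (ht0 : 0 ≤ t) (ht1 : t ≤ 1 / 2) :
    ENNReal.ofReal ((2 * t) ^ Module.finrank ℝ E) * μ ((1 - 1 / 2 : ℝ) • K + (1 / 2 : ℝ) • (-K)) ≤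
      μ ((1 - t) • K + t • (-K)) := by
  obtain ⟨k, hk⟩ := hKne
  have h1 := Measure.addHaar_smul μ (2 * t) ((1 - 1 / 2 : ℝ) • K + (1 / 2 : ℝ) • (-K))
  rw [abs_of_nonneg (by positivity)] at h1
  rw [← h1, ← measure_vadd μ ((1 - 2 * t) • k)]
  refine measure_mono ?_
  have h2 : (2 * t) • ((1 - 1 / 2 : ℝ) • K + (1 / 2 : ℝ) • (-K)) = t • K + t • (-K) := by
    rw [smul_add, smul_smul, smul_smul]
    congr 2 <;> ring
  have h3 : (1 - t) • K = (1 - 2 * t) • K + t • K := by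
    rw [← hK.add_smul (by linarith) ht0]
    congr 1
    ring
  rw [h2, h3, add_assoc]
  rintro _ ⟨x, hx, rfl⟩
  exact Set.add_mem_add (Set.smul_mem_smul_set hk) hx

end

section
variable {n : ℕ} {K : Set (EuclideanSpace ℝ (Fin n))}

theorem setIntegral_midpoint_le {F H : EuclideanSpace ℝ (Fin n) → ℝ} (hK : IsCompact K)
    (hF : Continuous F) (hH : Continuous H) (hF0 : ∀ x ∈ K, 0 ≤ F x) (hF0' : ∀ x ∈ K, 0 ≤ F (-x))
    (hH0 : ∀ x ∈ (1 - 1 / 2 : ℝ) • K + (1 / 2 : ℝ) • (-K), 0 ≤ H x)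
    (h : ∀ x ∈ K, ∀ y ∈ -K, F x * F y ≤ H ((1 - 1 / 2 : ℝ) • x + (1 / 2 : ℝ) • y) ^ 2)
    (hFG : ∫ x in K, F x = ∫ x in K, F (-x)) :
    ∫ x in K, F x ≤ ∫ x in (1 - 1 / 2 : ℝ) • K + (1 / 2 : ℝ) • (-K), H x := by
  have hF0'' : ∀ x ∈ -K, 0 ≤ F x := fun x hx => by simpa using hF0' (-x) hx
  refine (prekopaLeindler_euclideanSpace n).setIntegral_le (t := 1 / 2) (by norm_num) (by norm_num) hK hK.neg
    (isCompact_combo_neg hK _) hF hF hH hF0 hF0'' hH0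
    (fun x hx y hy => ?_) (by rw [hFG, setIntegral_neg_set])
  have hm := Set.add_mem_add (Set.smul_mem_smul_set (a := (1 - 1 / 2 : ℝ)) hx)
    (Set.smul_mem_smul_set (a := (1 / 2 : ℝ)) hy)
  refine ⟨hm, ?_⟩
  rw [show F x ^ (1 - 1 / 2 : ℝ) = √(F x) by rw [Real.sqrt_eq_rpow]; norm_num,
    ← Real.sqrt_eq_rpow, ← Real.sqrt_mul (hF0 x hx), Real.sqrt_le_left (hH0 _ hm)]
  exact h x hx y hy

theorem setIntegral_coord_sq_le (hK : IsCompact K)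
    (hc : ∀ i, ∫ x in K, x i = 0)
    (hV : volume ((1 - 1 / 2 : ℝ) • K + (1 / 2 : ℝ) • (-K)) = volume K) (i : Fin n) :
    ∫ x in K, x i ^ 2 ≤ ∫ x in (1 - 1 / 2 : ℝ) • K + (1 / 2 : ℝ) • (-K), x i ^ 2 := by
  obtain ⟨R, hR0, hR⟩ := hK.isBounded.exists_pos_norm_le
  have hKi : ∀ x ∈ K, |x i| ≤ R := fun x hx => (PiLp.norm_apply_le x i).trans (hR x hx)
  set T := (1 - 1 / 2 : ℝ) • K + (1 / 2 : ℝ) • (-K) with hTdef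
  have hT : IsCompact T := isCompact_combo_neg hK _
  have hTi : ∀ x ∈ T, |x i| ≤ R := by
    rintro _ ⟨_, ⟨x, hx, rfl⟩, _, ⟨y, hy, rfl⟩, rfl⟩
    have h1 := abs_le.1 (hKi x hx)
    have h2 := abs_le.1 (hKi _ hy)
    simp only [PiLp.add_apply, PiLp.smul_apply, PiLp.neg_apply, smul_eq_mul] at h1 h2 ⊢
    rw [abs_le]
    constructor <;> linarith
  have hTneg : -T = T := by
    rw [hTdef, Set.smul_set_neg, neg_add, neg_neg, add_comm]
    norm_num
  have hT0 : ∫ x in T, x i = 0 := by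
    have := setIntegral_neg_set (μ := volume) T (fun x => x i)
    rw [hTneg] at this
    simp only [PiLp.neg_apply, integral_neg] at this
    linarith
  have hexp : ∀ {A : Set (EuclideanSpace ℝ (Fin n))} (c : ℝ), IsCompact A → ∫ x in A, x i = 0 →
      ∫ x in A, (1 + c * x i) ^ 2 = (volume A).toReal + c ^ 2 * ∫ x in A, x i ^ 2 := by
    intro A c hA h0
    have hi : ∀ u : EuclideanSpace ℝ (Fin n) → ℝ, Continuous u → IntegrableOn u A := fun u hu =>
      hu.continuousOn.integrableOn_compact hA
    have e : ∀ x : EuclideanSpace ℝ (Fin n),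
      (1 + c * x i) ^ 2 = (1 + 2 * c * x i) + c ^ 2 * x i ^ 2 := fun x => by ring
    simp only [e]
    rw [integral_add (hi _ (by fun_prop)) (hi _ (by fun_prop)),
      integral_add (hi _ (by fun_prop)) (hi _ (by fun_prop)), integral_const_mul,
      integral_const_mul, h0]
    simp [Measure.real]
  have hpos : ∀ r : ℝ, |r| ≤ R → 0 ≤ 1 + R⁻¹ * r := fun r hr => by
    have := (abs_le.1 hr).1
    have h2 : R⁻¹ * (-R) ≤ R⁻¹ * r := by gcongr
    have h3 : R⁻¹ * (-R) = -1 := by field_simp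
    linarith
  have key := setIntegral_midpoint_le (F := fun x => (1 + R⁻¹ * x i) ^ 2)
    (H := fun x => (1 + R⁻¹ * x i) ^ 2) hK (by fun_prop) (by fun_prop)
    (fun x hx => sq_nonneg _) (fun x hx => sq_nonneg _) (fun x hx => sq_nonneg _)
    (fun x hx y hy => ?_) ?_
  · rw [hexp _ hK (hc i), hexp _ hT hT0, hV] at key
    have : 0 < R⁻¹ ^ 2 := by positivity
    nlinarith
  · have h1 := hpos _ (hKi x hx)
    have h2 := hpos _ (by simpa using hKi _ hy : |y i| ≤ R)
    simp only [PiLp.add_apply, PiLp.smul_apply, smul_eq_mul]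
    rw [← mul_pow]
    have h4 := mul_nonneg h1 h2
    refine pow_le_pow_left₀ h4 ?_ 2
    nlinarith [sq_nonneg (R⁻¹ * x i - R⁻¹ * y i)]
  · have := hexp (-R⁻¹) hK (hc i)
    rw [hexp _ hK (hc i)]
    simp only [PiLp.neg_apply, mul_neg, neg_mul, neg_sq] at this ⊢
    rw [this]

theorem neg_eq_of_volume_midpoint_eq (hK : IsCompact K) (hconv : Convex ℝ K)
    (hint : (interior K).Nonempty) (hc : ∀ i, ∫ x in K, x i = 0)
    (hV : volume ((1 - 1 / 2 : ℝ) • K + (1 / 2 : ℝ) • (-K)) = volume K) : -K = K := by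
  have hne : K.Nonempty := hint.mono interior_subset
  have hsq := setIntegral_coord_sq_le hK hc hV
  obtain ⟨R, hR0, hR⟩ := hK.isBounded.exists_pos_norm_le
  set T := (1 - 1 / 2 : ℝ) • K + (1 / 2 : ℝ) • (-K) with hTdef
  have hT : IsCompact T := isCompact_combo_neg hK _
  have hTneg : -T = T := by
    rw [hTdef, Set.smul_set_neg, neg_add, neg_neg, add_comm]
    norm_num
  have hTR : ∀ x ∈ T, ‖x‖ ≤ R := by
    rintro _ ⟨_, ⟨x, hx, rfl⟩, _, ⟨y, hy, rfl⟩, rfl⟩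
    have h1 := hR x hx
    have h2 := hR _ hy
    rw [norm_neg] at h2
    refine (norm_add_le _ _).trans ?_
    rw [norm_smul, norm_smul]
    norm_num
    linarith
  have hconvT : Convex ℝ T := (hconv.smul _).add (hconv.neg.smul _)
  have hintT : (interior T).Nonempty := by
    refine Set.Nonempty.mono subset_interior_add_left (Set.Nonempty.add ?_ hne.neg.smul_set)
    rw [interior_smul₀ (by norm_num)]
    exact hint.smul_set
  have hi : ∀ {A : Set (EuclideanSpace ℝ (Fin n))} {u : EuclideanSpace ℝ (Fin n) → ℝ},
      IsCompact A → Continuous u → IntegrableOn u A := fun hA hu =>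
    hu.continuousOn.integrableOn_compact hA
  have hnorm : ∫ x in K, ‖x‖ ^ 2 ≤ ∫ x in T, ‖x‖ ^ 2 := by
    simp only [EuclideanSpace.norm_sq_eq, Real.norm_eq_abs, sq_abs]
    rw [integral_finsetSum _ fun i _ => hi hK (by fun_prop),
      integral_finsetSum _ fun i _ => hi hT (by fun_prop)]
    exact Finset.sum_le_sum fun i _ => hsq i
  have hdist : ∀ x ∈ T, Metric.infDist x K ≤ 2 * R := fun x hx => by
    obtain ⟨k, hk⟩ := hne
    have := (Metric.infDist_le_dist_of_mem hk (x := x)).trans (dist_le_norm_add_norm x k)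
    linarith [hTR x hx, hR k hk]
  have hdc : Continuous fun x => Metric.infDist x K := Metric.continuous_infDist_pt K
  set ε : ℝ := (5 * R ^ 2)⁻¹ with hε
  have hε0 : 0 < ε := by positivity
  have hεR : ε * (5 * R ^ 2) = 1 := by rw [hε]; field_simp
  have hKsq : ∀ x ∈ K, 0 ≤ 1 - ε * ‖x‖ ^ 2 := fun x hx => by
    have : ‖x‖ ^ 2 ≤ 5 * R ^ 2 := by nlinarith [hR x hx, norm_nonneg x]
    nlinarith
  have key := setIntegral_midpoint_le (F := fun x => 1 - ε * ‖x‖ ^ 2)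
    (H := fun x => 1 - ε * (‖x‖ ^ 2 + Metric.infDist x K ^ 2)) hK (by fun_prop) (by fun_prop)
    hKsq (fun x hx => by simpa using hKsq x hx)
    (fun x hx => ?_) (fun x hx y hy => ?_) (by simp)
  · rw [integral_sub (hi hK (by fun_prop)) (hi hK (by fun_prop)),
      integral_sub (hi hT (by fun_prop)) (hi hT (by fun_prop)), integral_const_mul,
      integral_const_mul, integral_add (hi hT (by fun_prop)) (hi hT (by fun_prop))] at key
    simp only [setIntegral_const, Measure.real, smul_eq_mul, mul_one] at key
    rw [hV] at key
    have hle : ∫ x in T, Metric.infDist x K ^ 2 ≤ 0 := by nlinarith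
    have h0 : ∫ x in T, Metric.infDist x K ^ 2 = 0 :=
      le_antisymm hle (setIntegral_nonneg hT.measurableSet fun x _ => sq_nonneg _)
    rw [setIntegral_eq_zero_iff_of_nonneg_ae (ae_of_all _ fun x => sq_nonneg _)
      (hi hT (by fun_prop))] at h0
    have h0' : volume (interior T \ K) = 0 := by
      rw [Filter.EventuallyEq, ae_restrict_iff' hT.measurableSet] at h0
      refine measure_mono_null ?_ h0
      rintro x ⟨hxT, hxK⟩ hx
      have := hx (interior_subset hxT)
      simp only [Pi.zero_apply, pow_eq_zero_iff, ne_eq, OfNat.ofNat_ne_zero, not_false_eq_true]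
        at this
      exact hxK ((hK.isClosed.mem_iff_infDist_zero hne).2 this)
    rw [(isOpen_interior.sdiff hK.isClosed).measure_eq_zero_iff volume, Set.sdiff_eq_empty] at h0'
    have hTK : T ⊆ K := by
      refine subset_closure.trans ?_
      rw [← hconvT.closure_interior_eq_closure_of_nonempty_interior hintT]
      exact hK.isClosed.closure_subset_iff.2 h0'
    have hKT : K ⊆ T := subset_of_measure_le hT.isClosed hconv hint hTK hV.ge hT.measure_ne_top
    rw [hTK.antisymm hKT] at hTneg
    exact hTneg
  · have h1 : ‖x‖ ^ 2 ≤ R ^ 2 := pow_le_pow_left₀ (norm_nonneg _) (hTR x hx) 2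
    have h2 : Metric.infDist x K ^ 2 ≤ (2 * R) ^ 2 :=
      pow_le_pow_left₀ Metric.infDist_nonneg (hdist x hx) 2
    nlinarith
  · have hF1 := hKsq x hx
    have hF2 : 0 ≤ 1 - ε * ‖y‖ ^ 2 := by simpa using hKsq _ hy
    set z := (1 - 1 / 2 : ℝ) • x + (1 / 2 : ℝ) • y with hz
    have hd : Metric.infDist z K ^ 2 ≤ ‖(1 / 2 : ℝ) • (x - y)‖ ^ 2 := by
      refine pow_le_pow_left₀ Metric.infDist_nonneg ?_ 2
      refine (Metric.infDist_le_dist_of_mem hx).trans_eq ?_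
      rw [dist_comm, dist_eq_norm]
      congr 1
      rw [hz]
      module
    have hp := parallelogram_law_with_norm ℝ ((1 / 2 : ℝ) • x) ((1 / 2 : ℝ) • y)
    rw [← smul_sub, norm_smul, norm_smul] at hp
    have hz' : z = (1 / 2 : ℝ) • x + (1 / 2 : ℝ) • y := by rw [hz]; module
    rw [← hz', norm_smul] at hp
    rw [norm_smul] at hd
    norm_num at hp hd
    have hm : (1 - ε * ‖x‖ ^ 2 + (1 - ε * ‖y‖ ^ 2)) / 2 ≤
        1 - ε * (‖z‖ ^ 2 + Metric.infDist z K ^ 2) := by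
      have : ‖z‖ ^ 2 + Metric.infDist z K ^ 2 ≤ (‖x‖ ^ 2 + ‖y‖ ^ 2) / 2 := by nlinarith
      nlinarith
    calc (1 - ε * ‖x‖ ^ 2) * (1 - ε * ‖y‖ ^ 2)
        ≤ ((1 - ε * ‖x‖ ^ 2 + (1 - ε * ‖y‖ ^ 2)) / 2) ^ 2 := by
          nlinarith [sq_nonneg ((1 - ε * ‖x‖ ^ 2) - (1 - ε * ‖y‖ ^ 2))]
      _ ≤ _ := pow_le_pow_left₀ (by linarith) hm 2

theorem exists_center_of_volume_midpoint_eq (hK : IsCompact K) (hconv : Convex ℝ K)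
    (hint : (interior K).Nonempty)
    (hV : volume ((1 - 1 / 2 : ℝ) • K + (1 / 2 : ℝ) • (-K)) = volume K) :
    ∃ c : EuclideanSpace ℝ (Fin n), ∀ x, x ∈ K ↔ c + c - x ∈ K := by
  have hV0 : volume K ≠ 0 := (Measure.measure_pos_of_nonempty_interior _ hint).ne'
  have hVt : volume K ≠ ∞ := hK.measure_ne_top
  set c : EuclideanSpace ℝ (Fin n) :=
    WithLp.toLp 2 fun i => (volume K).toReal⁻¹ * ∫ x in K, x i with hcdef
  have hneg : -(-c +ᵥ K) = -c +ᵥ K := by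
    refine neg_eq_of_volume_midpoint_eq (hK.vadd _) (hconv.vadd _) ?_ (fun i => ?_) ?_
    · rw [interior_vadd]
      exact hint.vadd_set
    · have := (measurePreserving_vadd (-c) (volume : Measure (EuclideanSpace ℝ (Fin n)))
        ).setIntegral_image_emb (measurableEmbedding_const_vadd (-c)) (fun x => x i) K
      rw [← Set.image_vadd, this]
      simp only [vadd_eq_add, PiLp.add_apply, PiLp.neg_apply]
      rw [integral_add (continuousOn_const.integrableOn_compact hK)
        ((by fun_prop : Continuous fun x : EuclideanSpace ℝ (Fin n) =>
          x i).continuousOn.integrableOn_compact hK)]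
      simp only [setIntegral_const, smul_eq_mul, Measure.real, hcdef]
      have : (volume K).toReal ≠ 0 := ENNReal.toReal_ne_zero.2 ⟨hV0, hVt⟩
      field_simp
      ring
    · rw [measure_vadd, ← hV]
      congr 1
      rw [← Set.singleton_vadd, vadd_eq_add, neg_add, smul_add, smul_add]
      simp only [Set.neg_singleton, neg_neg, Set.smul_set_singleton]
      rw [add_add_add_comm, Set.singleton_add_singleton]
      have : (1 - 1 / 2 : ℝ) • -c + (1 / 2 : ℝ) • c = 0 := by module
      rw [this, Set.singleton_zero, zero_add]
  refine ⟨c, fun x => ?_⟩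
  have h1 : ∀ y, y ∈ K ↔ y - c ∈ -c +ᵥ K := fun y => by
    rw [Set.mem_vadd_set_iff_neg_vadd_mem]
    simp
  rw [h1 x, h1 (c + c - x), ← hneg, Set.mem_neg, hneg]
  congr! 1
  abel

theorem volume_combo_neg_of_center {c : EuclideanSpace ℝ (Fin n)}
    (hconv : Convex ℝ K) (hc : ∀ x, x ∈ K ↔ c + c - x ∈ K) {t : ℝ}
    (ht : t ∈ Set.Icc (0 : ℝ) 1) :
    volume ((1 - t) • K + t • (-K)) = volume K := by
  have : -K = -(c + c) +ᵥ K := by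
    ext x
    rw [Set.mem_vadd_set_iff_neg_vadd_mem, Set.mem_neg, hc (-x)]
    simp
  rw [this, ← Set.singleton_vadd, vadd_eq_add, smul_add, add_left_comm,
    ← hconv.add_smul (sub_nonneg.2 ht.2) ht.1, sub_add_cancel, one_smul, Set.smul_set_singleton,
    ← vadd_eq_add, Set.singleton_vadd, measure_vadd]

end

/-- The cone in `ℝ × E` over the set `{1} × K`. -/
def coneOver {E : Type*} [AddCommGroup E] [Module ℝ E] (K : Set E) : Set (ℝ × E) :=
  {p | 0 ≤ p.1 ∧ p.2 ∈ p.1 • K}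

/-- The differences `a - b` of points of the cone over `K` whose heights add up to `1`. -/
def coneBall {E : Type*} [AddCommGroup E] [Module ℝ E] (K : Set E) : Set (ℝ × E) :=
  {v | ∃ a ∈ coneOver K, ∃ b ∈ coneOver K, a.1 + b.1 = 1 ∧ a - b = v}

/-- The intersection of the cone over `K` with its translate by `v`, cut at height
`(1 + v.1) / 2`. -/
def coneSection {E : Type*} [AddCommGroup E] [Module ℝ E] (K : Set E) (v : ℝ × E) : Set E :=
  {y | ((1 + v.1) / 2, y) ∈ coneOver K ∧ ((1 + v.1) / 2, y) - v ∈ coneOver K}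

/-- The partial order on `ℝ × E` induced by the cone over `K` is a lattice: `0` and `v` always have
a supremum. -/
def HasConeSups {E : Type*} [AddCommGroup E] [Module ℝ E] (K : Set E) : Prop :=
  ∀ v : ℝ × E, ∃ w, ∀ p, (p ∈ coneOver K ∧ p - v ∈ coneOver K) ↔ p - w ∈ coneOver K

section Algebra
variable {E : Type*} [AddCommGroup E] [Module ℝ E] {K : Set E}

theorem mk_smul_mem_coneOver {s : ℝ} {k : E} (hs : 0 ≤ s) (hk : k ∈ K) :
    (s, s • k) ∈ coneOver K := ⟨hs, Set.smul_mem_smul_set hk⟩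

theorem exists_of_mem_coneOver {p : ℝ × E} (hp : p ∈ coneOver K) :
    ∃ k ∈ K, p = (p.1, p.1 • k) := by
  obtain ⟨_, k, hk, h⟩ := hp
  exact ⟨k, hk, Prod.ext rfl h.symm⟩

theorem eq_zero_of_mem_coneOver {p : ℝ × E} (hp : p ∈ coneOver K) (h : p.1 ≤ 0) : p = 0 := by
  obtain ⟨k, -, hk⟩ := exists_of_mem_coneOver hp
  have : p.1 = 0 := le_antisymm h hp.1
  rw [hk, this, zero_smul]
  rfl

theorem zero_mem_coneOver (hK : K.Nonempty) : (0 : ℝ × E) ∈ coneOver K := by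
  obtain ⟨k, hk⟩ := hK
  simpa using! mk_smul_mem_coneOver (le_refl (0 : ℝ)) hk

theorem smul_mem_coneOver {c : ℝ} (hc : 0 ≤ c) {p : ℝ × E} (hp : p ∈ coneOver K) :
    c • p ∈ coneOver K := by
  obtain ⟨k, hk, h⟩ := exists_of_mem_coneOver hp
  rw [h, Prod.smul_mk, ← smul_assoc]
  exact mk_smul_mem_coneOver (mul_nonneg hc hp.1) hk

theorem add_mem_coneOver (hK : Convex ℝ K) {p q : ℝ × E} (hp : p ∈ coneOver K)
    (hq : q ∈ coneOver K) : p + q ∈ coneOver K := by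
  refine ⟨add_nonneg hp.1 hq.1, ?_⟩
  rw [Prod.fst_add, hK.add_smul hp.1 hq.1]
  exact Set.add_mem_add hp.2 hq.2

theorem convex_coneOver (hK : Convex ℝ K) : Convex ℝ (coneOver K) :=
  fun _ hp _ hq _ _ ha hb _ =>
    add_mem_coneOver hK (smul_mem_coneOver ha hp) (smul_mem_coneOver hb hq)

theorem convex_coneBall (hK : Convex ℝ K) : Convex ℝ (coneBall K) := by
  rintro _ ⟨a, ha, b, hb, hab, rfl⟩ _ ⟨a', ha', b', hb', hab', rfl⟩ s t hs ht hst
  refine ⟨s • a + t • a', convex_coneOver hK ha ha' hs ht hst, s • b + t • b',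
    convex_coneOver hK hb hb' hs ht hst, ?_, by module⟩
  simp only [Prod.fst_add, Prod.smul_fst, smul_eq_mul]
  linear_combination s * hab + t * hab' + hst

theorem mk_mem_coneBall_iff {s : ℝ} {x : E} : (s, x) ∈ coneBall K ↔
    s ∈ Set.Icc (-1 : ℝ) 1 ∧ x ∈ ((1 + s) / 2) • K + ((1 - s) / 2) • (-K) := by
  constructor
  · rintro ⟨⟨a₁, a₂⟩, ⟨ha, ha'⟩, ⟨b₁, b₂⟩, ⟨hb, hb'⟩, hab, h⟩
    simp only [Prod.mk_sub_mk, Prod.mk.injEq] at hab h ha ha' hb hb'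
    obtain rfl : a₁ = (1 + s) / 2 := by linarith
    obtain rfl : b₁ = (1 - s) / 2 := by linarith
    refine ⟨⟨by linarith, by linarith⟩, a₂, ha', -b₂, ?_, by rw [← h.2]; exact (sub_eq_add_neg _ _).symm⟩
    rw [Set.smul_set_neg]
    simpa using hb'
  · rintro ⟨⟨h1, h2⟩, a, ha, b, hb, rfl⟩
    rw [Set.smul_set_neg] at hb
    exact ⟨((1 + s) / 2, a), ⟨by simp only; linarith, ha⟩, ((1 - s) / 2, -b),
      ⟨by simp only; linarith, hb⟩, by simp only; ring, by
        ext
        · simp only [Prod.mk_sub_mk]; ring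
        · simp⟩

end Algebra

section Topology
variable {E : Type*} [NormedAddCommGroup E] [NormedSpace ℝ E] {K : Set E}

theorem isClosed_coneOver (hK : IsCompact K) : IsClosed (coneOver K) := by
  refine IsSeqClosed.isClosed fun p x hp hx => ?_
  choose k hk hpk using fun n => exists_of_mem_coneOver (hp n)
  obtain ⟨l, hl, φ, hφ, hφl⟩ := hK.tendsto_subseq hk
  have h1 : Filter.Tendsto (fun n => (p n).1) Filter.atTop (nhds x.1) :=
    (continuous_fst.tendsto x).comp hx
  have h2 : Filter.Tendsto (fun n => ((p (φ n)).1, (p (φ n)).1 • k (φ n))) Filter.atTop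
      (nhds (x.1, x.1 • l)) :=
    (h1.comp hφ.tendsto_atTop).prodMk_nhds ((h1.comp hφ.tendsto_atTop).smul hφl)
  have h3 := hx.comp hφ.tendsto_atTop
  have h4 : x = (x.1, x.1 • l) := tendsto_nhds_unique h3 (h2.congr fun n => (hpk (φ n)).symm)
  rw [h4]
  exact mk_smul_mem_coneOver (ge_of_tendsto' h1 fun n => (hp n).1) hl

theorem isCompact_coneBall (hK : IsCompact K) : IsCompact (coneBall K) := by
  have : coneBall K = (fun q : ℝ × E × E => (2 * q.1 - 1, q.1 • q.2.1 - (1 - q.1) • q.2.2)) ''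
      (Set.Icc (0 : ℝ) 1 ×ˢ K ×ˢ K) := by
    ext v
    constructor
    · rintro ⟨a, ha, b, hb, hab, rfl⟩
      obtain ⟨k, hk, hak⟩ := exists_of_mem_coneOver ha
      obtain ⟨l, hl, hbl⟩ := exists_of_mem_coneOver hb
      refine ⟨(a.1, k, l), ⟨⟨ha.1, by linarith [hb.1]⟩, hk, hl⟩, ?_⟩
      have hb1 : b.1 = 1 - a.1 := by linarith
      rw [hak, hbl, hb1]
      ext
      · simp only [Prod.mk_sub_mk]; ring
      · simp
    · rintro ⟨⟨s, k, l⟩, ⟨⟨h0, h1⟩, hk, hl⟩, rfl⟩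
      refine ⟨_, mk_smul_mem_coneOver h0 hk, _, mk_smul_mem_coneOver (sub_nonneg.2 h1) hl,
        by simp, ?_⟩
      ext
      · simp only [Prod.mk_sub_mk]; ring
      · simp
  rw [this]
  exact (isCompact_Icc.prod (hK.prod hK)).image (by fun_prop)

theorem coneBall_mem_nhds (hint : (interior K).Nonempty) : coneBall K ∈ nhds (0 : ℝ × E) := by
  obtain ⟨k, hk⟩ := hint
  have hk' : K ∈ nhds k := mem_interior_iff_mem_nhds.1 hk
  have c1 : Filter.Tendsto (fun v : ℝ × E => k + (v.2 - v.1 • k)) (nhds 0) (nhds k) :=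
    Continuous.tendsto' (by fun_prop) _ _ (by simp)
  have c2 : Filter.Tendsto (fun v : ℝ × E => k - (v.2 - v.1 • k)) (nhds 0) (nhds k) :=
    Continuous.tendsto' (by fun_prop) _ _ (by simp)
  have c3 : Filter.Tendsto (fun v : ℝ × E => v.1) (nhds 0) (nhds 0) :=
    Continuous.tendsto' (by fun_prop) _ _ (by simp)
  filter_upwards [c1 hk', c2 hk', c3 (Icc_mem_nhds (by norm_num : (-1 : ℝ) < 0) one_pos)]
    with v h1 h2 h3
  refine ⟨_, mk_smul_mem_coneOver (s := (1 + v.1) / 2) (by linarith [h3.1]) h1, _,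
    mk_smul_mem_coneOver (s := (1 - v.1) / 2) (by linarith [h3.2]) h2, by simp only; ring, ?_⟩
  ext
  · simp only [Prod.mk_sub_mk]; ring
  · simp only [Prod.mk_sub_mk]; module

theorem gauge_coneBall_sub_le {a b : ℝ × E} (ha : a ∈ coneOver K) (hb : b ∈ coneOver K) :
    gauge (coneBall K) (a - b) ≤ a.1 + b.1 := by
  have ha1 := ha.1
  have hb1 := hb.1
  rcases (add_nonneg ha1 hb1).eq_or_lt with h | h
  · rw [eq_zero_of_mem_coneOver ha (by linarith), eq_zero_of_mem_coneOver hb (by linarith)]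
    simp
  · refine gauge_le_of_mem h.le ?_
    rw [Set.mem_smul_set_iff_inv_smul_mem₀ h.ne']
    refine ⟨_, smul_mem_coneOver (inv_nonneg.2 h.le) ha, _,
      smul_mem_coneOver (inv_nonneg.2 h.le) hb, ?_, (smul_sub _ _ _).symm⟩
    simp only [Prod.smul_fst, smul_eq_mul]
    field_simp

theorem exists_sub_eq_gauge_coneBall (hK : IsCompact K) (hconv : Convex ℝ K)
    (hint : (interior K).Nonempty) (v : ℝ × E) :
    ∃ a ∈ coneOver K, ∃ b ∈ coneOver K, a - b = v ∧ a.1 + b.1 = gauge (coneBall K) v := by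
  have hn := coneBall_mem_nhds hint
  have hC := isCompact_coneBall hK
  rcases eq_or_ne v 0 with rfl | hv
  · exact ⟨0, zero_mem_coneOver (hint.mono interior_subset), 0,
      zero_mem_coneOver (hint.mono interior_subset), by simp, by simp⟩
  have hpos : 0 < gauge (coneBall K) v :=
    (gauge_pos (absorbent_nhds_zero hn) (NormedSpace.isVonNBounded_of_isBounded ℝ hC.isBounded)).2 hv
  set r := gauge (coneBall K) v with hr
  have h1 : gauge (coneBall K) (r⁻¹ • v) ≤ 1 := by
    rw [gauge_smul_of_nonneg (inv_nonneg.2 hpos.le), smul_eq_mul, ← hr, inv_mul_cancel₀ hpos.ne']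
  rw [gauge_le_one_iff_mem_closure (convex_coneBall hconv) hn, hC.isClosed.closure_eq] at h1
  obtain ⟨a, ha, b, hb, hab, h⟩ := h1
  refine ⟨r • a, smul_mem_coneOver hpos.le ha, r • b, smul_mem_coneOver hpos.le hb, ?_, ?_⟩
  · rw [← smul_sub, h, smul_inv_smul₀ hpos.ne']
  · simp only [Prod.smul_fst, smul_eq_mul]
    rw [← mul_add, hab, mul_one]

theorem isClosed_coneSection (hK : IsCompact K) (v : ℝ × E) : IsClosed (coneSection K v) :=
  ((isClosed_coneOver hK).preimage (by fun_prop : Continuous fun y : E => ((1 + v.1) / 2, y))).inter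
    ((isClosed_coneOver hK).preimage
      (by fun_prop : Continuous fun y : E => ((1 + v.1) / 2, y) - v))

theorem isCompact_coneSection (hK : IsCompact K) (v : ℝ × E) : IsCompact (coneSection K v) :=
  (hK.smul ((1 + v.1) / 2)).of_isClosed_subset (isClosed_coneSection hK v) fun _ hy => hy.1.2

theorem convex_coneSection (hK : Convex ℝ K) (v : ℝ × E) : Convex ℝ (coneSection K v) := by
  rintro x ⟨hx, hx'⟩ y ⟨hy, hy'⟩ s t hs ht hst
  refine ⟨?_, ?_⟩
  · convert convex_coneOver hK hx hy hs ht hst using 1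
    ext
    · simp only [Prod.smul_mk, Prod.mk_add_mk, smul_eq_mul]; linear_combination -(1 + v.1) / 2 * hst
    · rfl
  · convert convex_coneOver hK hx' hy' hs ht hst using 1
    ext
    · simp only [smul_eq_mul, Prod.fst_sub, Prod.smul_fst,
        Prod.fst_add]
      linear_combination (-(1 + v.1) / 2 + v.1) * hst
    · have : s • (x - v.2) + t • (y - v.2) = s • x + t • y - (s + t) • v.2 := by module
      simp [this, hst]

theorem coneSection_combo_subset (hK : Convex ℝ K) {v : ℝ × E} {a b : ℝ × E}
    (ha : a ∈ coneOver K) (hb : b ∈ coneOver K) (hab : a - b = v) {r : ℝ} (hr : a.1 + b.1 = r)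
    (hr1 : r ≤ 1) : a.2 +ᵥ ((1 - r) / 2) • K ⊆ coneSection K v := by
  rintro _ ⟨_, ⟨k, hk, rfl⟩, rfl⟩
  have h := mk_smul_mem_coneOver (s := (1 - r) / 2) (by linarith) hk
  have hv : v.1 = a.1 - b.1 := by rw [← hab]; rfl
  refine ⟨?_, ?_⟩
  · convert add_mem_coneOver hK ha h using 1
    ext
    · simp only [Prod.fst_add]; linarith
    · rfl
  · convert add_mem_coneOver hK hb h using 1
    ext
    · simp only [Prod.fst_add, Prod.fst_sub]; linarith
    · simp [← hab, add_comm]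

end Topology

theorem lintegral_measure_inter_sub_mem {E : Type*} [NormedAddCommGroup E] [MeasurableSpace E]
    [BorelSpace E] [SecondCountableTopology E] {μ : Measure E} [μ.IsAddLeftInvariant]
    [μ.IsNegInvariant] [SFinite μ] {A B : Set E} (hA : MeasurableSet A) (hB : MeasurableSet B) :
    ∫⁻ x, μ {y | y ∈ A ∧ y - x ∈ B} ∂μ = μ A * μ B := by
  have hm : MeasurableSet {q : E × E | q.2 ∈ A ∧ q.2 - q.1 ∈ B} :=
    (measurable_snd hA).inter ((measurable_snd.sub measurable_fst) hB)
  have h1 := Measure.prod_apply (μ := μ) (ν := μ) hm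
  rw [Measure.prod_apply_symm hm] at h1
  simp only [Set.preimage_ofPred_eq] at h1
  rw [← h1, ← lintegral_indicator_const hA (μ B) |>.trans (mul_comm _ _)]
  refine lintegral_congr fun y => ?_
  by_cases hy : y ∈ A
  · simp only [hy, true_and, Set.indicator_of_mem]
    exact (Measure.measurePreserving_sub_left μ y).measure_preimage hB.nullMeasurableSet
  · simp [hy]

theorem integral_pow_mul_one_sub_pow_succ (d : ℕ) (hd : d ≠ 0) :
    (d : ℝ) * ∫ t in (0 : ℝ)..1, t ^ (d - 1) * (1 - t) ^ (d + 1) =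
      (d + 1) * ∫ t in (0 : ℝ)..1, t ^ d * (1 - t) ^ d := by
  have h : ∀ t ∈ Set.uIcc (0 : ℝ) 1, HasDerivAt (fun t : ℝ => t ^ d * (1 - t) ^ (d + 1))
      (d * (t ^ (d - 1) * (1 - t) ^ (d + 1)) - (d + 1) * (t ^ d * (1 - t) ^ d)) t := by
    intro t _
    refine ((hasDerivAt_pow d t).mul
      (((hasDerivAt_id t).const_sub 1).pow (d + 1))).congr_deriv ?_
    simp only [Pi.pow_apply, id, Nat.add_sub_cancel]
    push_cast
    ring
  have := intervalIntegral.integral_eq_sub_of_hasDerivAt h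
    (Continuous.intervalIntegrable (by fun_prop) _ _)
  rw [intervalIntegral.integral_sub (Continuous.intervalIntegrable (by fun_prop) _ _)
    (Continuous.intervalIntegrable (by fun_prop) _ _), intervalIntegral.integral_const_mul,
    intervalIntegral.integral_const_mul] at this
  simp [hd] at this
  linarith

theorem setLIntegral_Icc_eq_two_mul {f : ℝ → ℝ} (hf : IntervalIntegrable f volume 0 1)
    (hf0 : ∀ t ∈ Set.Icc (0 : ℝ) 1, 0 ≤ f t) :
    ∫⁻ s in Set.Icc (-1 : ℝ) 1, ENNReal.ofReal (f ((1 - s) / 2)) =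
      ENNReal.ofReal (2 * ∫ t in (0 : ℝ)..1, f t) := by
  have h1 : IntervalIntegrable (fun s => f ((1 - s) / 2)) volume (-1) 1 := by
    have := (hf.comp_mul_left (c := -1/2)).comp_add_right (-1)
    convert! this.symm using 1
    · ext s; congr 1; ring
    · norm_num
    · norm_num
  have h2 : ∫ s in (-1 : ℝ)..1, f ((1 - s) / 2) = 2 * ∫ t in (0 : ℝ)..1, f t := by
    have := intervalIntegral.integral_comp_sub_mul f (c := 1 / 2) (by norm_num) (1 / 2)
      (a := -1) (b := 1)
    rw [show (1 : ℝ) / 2 - 1 / 2 * 1 = 0 by norm_num, show (1 : ℝ) / 2 - 1 / 2 * -1 = 1 by norm_num,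
      smul_eq_mul, show ((1 : ℝ) / 2)⁻¹ = 2 by norm_num] at this
    rw [← this]
    congr 1; ext s; congr 1; ring
  rw [← h2, intervalIntegral.integral_of_le (by norm_num), ← integral_Icc_eq_integral_Ioc,
    ofReal_integral_eq_lintegral_ofReal]
  · change IntegrableOn _ _ _
    rwa [integrableOn_Icc_iff_integrableOn_Ioc, ← intervalIntegrable_iff_integrableOn_Ioc_of_le
      (by norm_num)]
  · refine (ae_restrict_iff' measurableSet_Icc).2 (ae_of_all _ fun s hs => hf0 _ ⟨?_, ?_⟩)
    · linarith [hs.2]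
    · linarith [hs.1]

theorem coneSection_mk_of_mem {E : Type*} [AddCommGroup E] [Module ℝ E] {K : Set E} {s : ℝ}
    (hs : s ∈ Set.Icc (-1 : ℝ) 1) (x : E) :
    coneSection K (s, x) = {y | y ∈ ((1 + s) / 2) • K ∧ y - x ∈ ((1 - s) / 2) • K} := by
  have h1 : (1 + s) / 2 - s = (1 - s) / 2 := by ring
  have h2 : 0 ≤ (1 + s) / 2 := by linarith [hs.1]
  have h3 : 0 ≤ (1 - s) / 2 := by linarith [hs.2]
  ext y
  simp [coneSection, coneOver, h1, h2, h3]

theorem coneSection_mk_of_notMem {E : Type*} [AddCommGroup E] [Module ℝ E] {K : Set E} {s : ℝ}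
    (hs : s ∉ Set.Icc (-1 : ℝ) 1) (x : E) :
    coneSection K (s, x) = ∅ := by
  ext y
  simp only [Set.mem_empty_iff_false, iff_false]
  rintro ⟨h1, h2⟩
  have h1 := h1.1
  have h2 := h2.1
  simp only [Prod.mk_sub_mk] at h1 h2
  exact hs ⟨by linarith, by linarith⟩

section
variable {E : Type*} [NormedAddCommGroup E] [NormedSpace ℝ E] [FiniteDimensional ℝ E]
  [MeasurableSpace E] [BorelSpace E] {μ : Measure E} [μ.IsAddHaarMeasure] {K : Set E}

local notation "dim" => Module.finrank ℝ E

theorem measurable_measure_coneSection (hK : IsCompact K) :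
    Measurable fun v => μ (coneSection K v) := by
  have : IsClosed {q : (ℝ × E) × E | q.2 ∈ coneSection K q.1} :=
    ((isClosed_coneOver hK).preimage
      (by fun_prop : Continuous fun q : (ℝ × E) × E => ((1 + q.1.1) / 2, q.2))).inter
    ((isClosed_coneOver hK).preimage
      (by fun_prop : Continuous fun q : (ℝ × E) × E => ((1 + q.1.1) / 2, q.2) - q.1))
  exact measurable_measure_prodMk_left this.measurableSet

variable (μ) in
theorem lintegral_measure_coneSection (hK : IsCompact K) :
    ∫⁻ v, μ (coneSection K v) ∂((volume : Measure ℝ).prod μ) =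
      μ K * μ K * ENNReal.ofReal (2 * ∫ t in (0 : ℝ)..1, t ^ dim * (1 - t) ^ dim) := by
  rw [lintegral_prod _ (measurable_measure_coneSection hK).aemeasurable,
    ← setLIntegral_Icc_eq_two_mul (Continuous.intervalIntegrable (by fun_prop) _ _)
      fun t ht => mul_nonneg (pow_nonneg ht.1 _) (pow_nonneg (sub_nonneg.2 ht.2) _),
    ← lintegral_const_mul _ (by fun_prop), ← lintegral_indicator measurableSet_Icc]
  refine lintegral_congr fun s => ?_
  by_cases hs : s ∈ Set.Icc (-1 : ℝ) 1
  · have h2 : 0 ≤ (1 + s) / 2 := by linarith [hs.1]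
    have h3 : 0 ≤ (1 - s) / 2 := by linarith [hs.2]
    have h4 : 1 - (1 - s) / 2 = (1 + s) / 2 := by ring
    simp only [coneSection_mk_of_mem hs, Set.indicator_of_mem hs]
    rw [lintegral_measure_inter_sub_mem (hK.smul _).measurableSet (hK.smul _).measurableSet,
      Measure.addHaar_smul_of_nonneg _ h2, Measure.addHaar_smul_of_nonneg _ h3, h4,
      ENNReal.ofReal_mul (by positivity)]
    ring
  · simp [coneSection_mk_of_notMem hs, Set.indicator_of_notMem hs]

theorem coneBall_apply_prod (hK : IsCompact K) : (volume.prod μ) (coneBall K) =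
    ∫⁻ s in Set.Icc (-1 : ℝ) 1, μ ((1 - (1 - s) / 2) • K + ((1 - s) / 2) • (-K)) := by
  rw [Measure.prod_apply (isCompact_coneBall hK).measurableSet, ← lintegral_indicator
    measurableSet_Icc]
  refine lintegral_congr fun s => ?_
  by_cases hs : s ∈ Set.Icc (-1 : ℝ) 1
  · rw [Set.indicator_of_mem hs]
    congr 1
    ext x
    rw [Set.mem_preimage, mk_mem_coneBall_iff, show 1 - (1 - s) / 2 = (1 + s) / 2 by ring]
    exact and_iff_right hs
  · rw [Set.indicator_of_notMem hs]
    convert measure_empty (μ := μ)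
    ext x
    simp only [Set.mem_preimage, mk_mem_coneBall_iff, hs, false_and, Set.mem_empty_iff_false]

theorem intervalIntegrable_combo_neg (hK : IsCompact K) :
    IntervalIntegrable (fun t => (μ ((1 - t) • K + t • (-K))).toReal) volume 0 1 := by
  have hm : Measurable fun s => μ (Prod.mk s ⁻¹' coneBall K) :=
    measurable_measure_prodMk_left (isCompact_coneBall hK).measurableSet
  have h1 : IntegrableOn (fun s => (μ (Prod.mk s ⁻¹' coneBall K)).toReal) Set.univ volume := by
    rw [integrableOn_univ]
    refine integrable_toReal_of_lintegral_ne_top hm.aemeasurable ?_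
    rw [← Measure.prod_apply (isCompact_coneBall hK).measurableSet]
    exact (isCompact_coneBall hK).measure_ne_top
  have h2 : IntervalIntegrable (fun s => (μ (Prod.mk s ⁻¹' coneBall K)).toReal) volume 1 (-1) :=
    (h1.mono_set (Set.subset_univ _)).intervalIntegrable
  have h3 := (h2.comp_mul_left (c := -2)).comp_add_right (-1/2)
  rw [show (1 : ℝ) / -2 - -1 / 2 = 0 by norm_num, show (-1 : ℝ) / -2 - -1 / 2 = 1 by norm_num] at h3
  refine h3.congr fun t ht => ?_
  rw [Set.uIoc_of_le zero_le_one] at ht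
  congr 2
  ext x
  rw [Set.mem_preimage, mk_mem_coneBall_iff, show (1 + -2 * (t + -1 / 2)) / 2 = 1 - t by ring,
    show (1 - -2 * (t + -1 / 2)) / 2 = t by ring]
  exact and_iff_right ⟨by linarith [ht.2], by linarith [ht.1]⟩

theorem measure_coneBall (hK : IsCompact K) : (volume.prod μ) (coneBall K) =
    ENNReal.ofReal (2 * ∫ t in (0 : ℝ)..1, (μ ((1 - t) • K + t • (-K))).toReal) := by
  rw [coneBall_apply_prod hK, ← setLIntegral_Icc_eq_two_mul (intervalIntegrable_combo_neg hK)
    fun _ _ => ENNReal.toReal_nonneg]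
  refine lintegral_congr fun s => ?_
  rw [ENNReal.ofReal_toReal (isCompact_combo_neg hK _).measure_ne_top]

end

theorem continuous_gauge_coneBall {E : Type*} [NormedAddCommGroup E] [NormedSpace ℝ E] {K : Set E}
    (hconv : Convex ℝ K) (hint : (interior K).Nonempty) :
    Continuous (gauge (coneBall K)) :=
  continuous_gauge (convex_coneBall hconv) (coneBall_mem_nhds hint)

theorem gauge_coneBall_le_iff {E : Type*} [NormedAddCommGroup E] [NormedSpace ℝ E] {K : Set E}
    (hK : IsCompact K) (hconv : Convex ℝ K)
    (hint : (interior K).Nonempty) {r : ℝ} (hr : 0 ≤ r) {v : ℝ × E} :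
    gauge (coneBall K) v ≤ r ↔ v ∈ r • coneBall K := by
  refine ⟨fun h => ?_, gauge_le_of_mem hr⟩
  obtain ⟨a, ha, b, hb, hab, hN⟩ := exists_sub_eq_gauge_coneBall hK hconv hint v
  have hz : (0 : ℝ × E) ∈ coneBall K := mem_of_mem_nhds (coneBall_mem_nhds hint)
  rw [← hN] at h
  have hs : 0 ≤ a.1 + b.1 := add_nonneg ha.1 hb.1
  have hv : v ∈ (a.1 + b.1) • coneBall K := by
    rcases hs.eq_or_lt with h0 | h0
    · rw [← hab, eq_zero_of_mem_coneOver ha (by linarith [hb.1]),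
        eq_zero_of_mem_coneOver hb (by linarith [ha.1])]
      exact ⟨0, hz, by simp⟩
    · rw [Set.mem_smul_set_iff_inv_smul_mem₀ h0.ne']
      refine ⟨_, smul_mem_coneOver (inv_nonneg.2 hs) ha, _,
        smul_mem_coneOver (inv_nonneg.2 hs) hb, ?_, by rw [← smul_sub, hab]⟩
      simp only [Prod.smul_fst, smul_eq_mul]
      field_simp
  rcases hr.eq_or_lt with h0 | h0
  · rwa [← h0, ← le_antisymm (h.trans h0.ge) hs]
  obtain ⟨c, hc, rfl⟩ := hv
  refine ⟨((a.1 + b.1) / r) • c, ?_, ?_⟩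
  · exact (convex_coneBall hconv).smul_mem_of_zero_mem hz hc
      ⟨div_nonneg hs hr, (div_le_one h0).2 h⟩
  · simp only [smul_smul]
    rw [mul_div_cancel₀ _ h0.ne']

section
variable {E : Type*} [NormedAddCommGroup E] [NormedSpace ℝ E] [FiniteDimensional ℝ E]
  [MeasurableSpace E] [BorelSpace E] {μ : Measure E} [μ.IsAddHaarMeasure] {K : Set E}

local notation "dim" => Module.finrank ℝ E

theorem measure_coneSection_ge (hK : IsCompact K) (hconv : Convex ℝ K)
    (hint : (interior K).Nonempty) (hd : dim ≠ 0) (v : ℝ × E) :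
    ENNReal.ofReal (max ((1 - gauge (coneBall K) v) / 2) 0 ^ dim) * μ K ≤
      μ (coneSection K v) := by
  rcases le_total (gauge (coneBall K) v) 1 with h | h
  · obtain ⟨a, ha, b, hb, hab, hN⟩ := exists_sub_eq_gauge_coneBall hK hconv hint v
    refine le_trans (le_of_eq ?_) (measure_mono (coneSection_combo_subset hconv ha hb hab hN h))
    rw [measure_vadd, Measure.addHaar_smul_of_nonneg _ (by linarith), max_eq_left (by linarith)]
  · rw [max_eq_right (by linarith), zero_pow hd]
    simp

theorem lintegral_max_one_sub_gauge_coneBall_pow (hK : IsCompact K) (hconv : Convex ℝ K)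
    (hint : (interior K).Nonempty) (hd : dim ≠ 0) :
    ∫⁻ v, ENNReal.ofReal (max (1 - gauge (coneBall K) v) 0 ^ dim) ∂(volume.prod μ) =
      (volume.prod μ) (coneBall K) *
        ENNReal.ofReal ((dim + 1) * ∫ t in (0 : ℝ)..1, t ^ dim * (1 - t) ^ dim) := by
  have hc := continuous_gauge_coneBall hconv hint
  have hd' : (0 : ℝ) < dim := by exact_mod_cast Nat.pos_of_ne_zero hd
  have h := lintegral_rpow_eq_lintegral_meas_le_mul (volume.prod μ)
    (f := fun v => max (1 - gauge (coneBall K) v) 0) (ae_of_all _ fun v => le_max_right _ _)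
    (by fun_prop) hd'
  simp only [Real.rpow_natCast] at h
  rw [h, ← integral_pow_mul_one_sub_pow_succ _ hd, ENNReal.ofReal_mul hd'.le, mul_left_comm]
  congr 1
  rw [intervalIntegral.integral_of_le zero_le_one, ofReal_integral_eq_lintegral_ofReal
    (Continuous.integrableOn_Ioc (by fun_prop))
    ((ae_restrict_iff' measurableSet_Ioc).2 (ae_of_all _ fun t ht =>
      mul_nonneg (pow_nonneg ht.1.le _) (pow_nonneg (sub_nonneg.2 ht.2) _))),
    ← lintegral_const_mul _ (by fun_prop), ← lintegral_indicator measurableSet_Ioc,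
    ← lintegral_indicator measurableSet_Ioi]
  refine lintegral_congr fun t => ?_
  by_cases ht0 : 0 < t
  · rw [Set.indicator_of_mem (Set.mem_Ioi.2 ht0)]
    by_cases ht1 : t ≤ 1
    · rw [Set.indicator_of_mem (show t ∈ Set.Ioc (0 : ℝ) 1 from ⟨ht0, ht1⟩)]
      have : {v | t ≤ max (1 - gauge (coneBall K) v) 0} = (1 - t) • coneBall K := by
        ext v
        rw [← gauge_coneBall_le_iff hK hconv hint (sub_nonneg.2 ht1)]
        simp only [Set.mem_ofPred_eq, le_max_iff, ht0.not_ge, or_false]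
        constructor <;> intro <;> linarith
      rw [this, Measure.addHaar_smul_of_nonneg _ (sub_nonneg.2 ht1), Module.finrank_prod,
        Module.finrank_self, add_comm 1, ENNReal.ofReal_mul (pow_nonneg ht0.le _),
        ← Nat.cast_pred (Nat.pos_of_ne_zero hd), Real.rpow_natCast]
      ring
    · have : {v | t ≤ max (1 - gauge (coneBall K) v) 0} = ∅ := by
        ext v
        have := gauge_nonneg (s := coneBall K) v
        simp only [Set.mem_ofPred_eq, le_max_iff, ht0.not_ge, or_false, Set.mem_empty_iff_false,
          iff_false]
        intro; linarith
      rw [Set.indicator_of_notMem fun h : t ∈ Set.Ioc (0 : ℝ) 1 => ht1 h.2, this]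
      simp
  · rw [Set.indicator_of_notMem fun h : t ∈ Set.Ioi (0 : ℝ) => ht0 h,
      Set.indicator_of_notMem fun h : t ∈ Set.Ioc (0 : ℝ) 1 => ht0 h.1]

theorem lintegral_coneBound (hK : IsCompact K) (hconv : Convex ℝ K)
    (hint : (interior K).Nonempty) (hd : dim ≠ 0) :
    ∫⁻ v, ENNReal.ofReal (max ((1 - gauge (coneBall K) v) / 2) 0 ^ dim) * μ K ∂(volume.prod μ) =
      ENNReal.ofReal (((dim + 1) / 2 ^ dim *
        ∫ t in (0 : ℝ)..1, (μ ((1 - t) • K + t • (-K))).toReal) * (μ K).toReal *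
        (2 * ∫ t in (0 : ℝ)..1, t ^ dim * (1 - t) ^ dim)) := by
  have hc := continuous_gauge_coneBall hconv hint
  have hI : 0 ≤ ∫ t in (0 : ℝ)..1, (μ ((1 - t) • K + t • (-K))).toReal :=
    intervalIntegral.integral_nonneg zero_le_one fun _ _ => ENNReal.toReal_nonneg
  have h : ∀ v : ℝ × E, ENNReal.ofReal (max ((1 - gauge (coneBall K) v) / 2) 0 ^ dim) * μ K =
      ENNReal.ofReal ((1 / 2) ^ dim) * μ K *
        ENNReal.ofReal (max (1 - gauge (coneBall K) v) 0 ^ dim) := fun v => by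
    rw [mul_right_comm, ← ENNReal.ofReal_mul (by positivity), ← mul_pow, mul_max_of_nonneg _ _
      (by norm_num), mul_zero, one_div_mul_eq_div]
  simp only [h]
  rw [lintegral_const_mul _ (by fun_prop), lintegral_max_one_sub_gauge_coneBall_pow hK hconv hint hd,
    measure_coneBall hK, ← ENNReal.ofReal_toReal (hK.measure_ne_top (μ := μ)),
    ENNReal.toReal_ofReal ENNReal.toReal_nonneg, ← ENNReal.ofReal_mul (by positivity),
    ← ENNReal.ofReal_mul (by positivity), ← ENNReal.ofReal_mul (by positivity)]
  congr 1
  rw [one_div_pow]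
  field_simp

variable (μ) in
theorem lintegral_measure_coneSection_eq_ofReal (hK : IsCompact K) :
    ∫⁻ v, μ (coneSection K v) ∂((volume : Measure ℝ).prod μ) =
      ENNReal.ofReal ((μ K).toReal * (μ K).toReal *
        (2 * ∫ t in (0 : ℝ)..1, t ^ dim * (1 - t) ^ dim)) := by
  rw [lintegral_measure_coneSection μ hK, ENNReal.ofReal_mul (p := _ * _) (by positivity),
    ENNReal.ofReal_mul (p := (μ K).toReal) (by positivity),
    ENNReal.ofReal_toReal hK.measure_ne_top]

theorem integral_pow_mul_one_sub_pow_pos (d : ℕ) :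
    0 < ∫ t in (0 : ℝ)..1, t ^ d * (1 - t) ^ d :=
  intervalIntegral.intervalIntegral_pos_of_pos_on (Continuous.intervalIntegrable (by fun_prop) _ _)
    (fun t ht => mul_pos (pow_pos ht.1 _) (pow_pos (sub_pos.2 ht.2) _)) one_pos

theorem integral_combo_neg_le (hK : IsCompact K) (hconv : Convex ℝ K)
    (hint : (interior K).Nonempty) (hd : dim ≠ 0) :
    ∫ t in (0 : ℝ)..1, (μ ((1 - t) • K + t • (-K))).toReal ≤
      2 ^ dim / (dim + 1) * (μ K).toReal := by
  have h := lintegral_mono (μ := volume.prod μ) (measure_coneSection_ge (μ := μ) hK hconv hint hd)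
  have hB := integral_pow_mul_one_sub_pow_pos dim
  have hV : 0 < (μ K).toReal := ENNReal.toReal_pos
    (Measure.measure_pos_of_nonempty_interior μ hint).ne' hK.measure_ne_top
  rw [lintegral_coneBound hK hconv hint hd, lintegral_measure_coneSection_eq_ofReal μ hK,
    ENNReal.ofReal_le_ofReal_iff (by positivity), mul_le_mul_iff_left₀ (by positivity),
    mul_le_mul_iff_left₀ hV] at h
  rw [div_mul_eq_mul_div, le_div_iff₀ (by positivity)]
  rw [div_mul_eq_mul_div, div_le_iff₀ (by positivity)] at h
  linarith

theorem integral_combo_neg_eq_iff (hK : IsCompact K) (hconv : Convex ℝ K)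
    (hint : (interior K).Nonempty) (hd : dim ≠ 0) :
    ∫ t in (0 : ℝ)..1, (μ ((1 - t) • K + t • (-K))).toReal = 2 ^ dim / (dim + 1) * (μ K).toReal ↔
    ∀ᵐ v ∂((volume : Measure ℝ).prod μ),
      ENNReal.ofReal (max ((1 - gauge (coneBall K) v) / 2) 0 ^ dim) * μ K =
        μ (coneSection K v) := by
  have hB := integral_pow_mul_one_sub_pow_pos dim
  have hI : 0 ≤ ∫ t in (0 : ℝ)..1, (μ ((1 - t) • K + t • (-K))).toReal :=
    intervalIntegral.integral_nonneg zero_le_one fun _ _ => ENNReal.toReal_nonneg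
  have hV : 0 < (μ K).toReal := ENNReal.toReal_pos
    (Measure.measure_pos_of_nonempty_interior μ hint).ne' hK.measure_ne_top
  have key : ∫ t in (0 : ℝ)..1, (μ ((1 - t) • K + t • (-K))).toReal =
      2 ^ dim / (dim + 1) * (μ K).toReal ↔
      ∫⁻ v, ENNReal.ofReal (max ((1 - gauge (coneBall K) v) / 2) 0 ^ dim) * μ K ∂(volume.prod μ) =
      ∫⁻ v, μ (coneSection K v) ∂((volume : Measure ℝ).prod μ) := by
    rw [lintegral_coneBound hK hconv hint hd, lintegral_measure_coneSection_eq_ofReal μ hK,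
      ENNReal.ofReal_eq_ofReal_iff (by positivity) (by positivity), mul_left_inj' (by positivity),
      mul_left_inj' hV.ne', div_mul_eq_mul_div, div_mul_eq_mul_div, div_eq_iff (by positivity),
      eq_div_iff (by positivity)]
    constructor <;> intro <;> linarith
  rw [key]
  refine ⟨fun h => ?_, lintegral_congr_ae⟩
  refine ae_eq_of_ae_le_of_lintegral_le (ae_of_all _ (measure_coneSection_ge hK hconv hint hd)) ?_
    (measurable_measure_coneSection hK).aemeasurable h.ge
  rw [lintegral_coneBound hK hconv hint hd]
  exact ENNReal.ofReal_ne_top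

end

theorem smul_mem_coneOver_iff {E : Type*} [AddCommGroup E] [Module ℝ E] {K : Set E} {c : ℝ}
    (hc : 0 < c) {p : ℝ × E} : c • p ∈ coneOver K ↔ p ∈ coneOver K :=
  ⟨fun h => by simpa [smul_smul, inv_mul_cancel₀ hc.ne'] using
    smul_mem_coneOver (inv_nonneg.2 hc.le) h, smul_mem_coneOver hc.le⟩

section
variable {E : Type*} [NormedAddCommGroup E] [NormedSpace ℝ E] [FiniteDimensional ℝ E]
  [MeasurableSpace E] [BorelSpace E] {μ : Measure E} [μ.IsAddHaarMeasure] {K : Set E}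

local notation "dim" => Module.finrank ℝ E

theorem le_measure_coneSection_combo (hconv : Convex ℝ K)
    {v q : ℝ × E} (hq : (coneSection K q).Nonempty) {t : ℝ} (ht0 : 0 ≤ t) (ht1 : t ≤ 1) :
    ENNReal.ofReal ((1 - t) ^ dim) * μ (coneSection K v) ≤
      μ (coneSection K ((1 - t) • v + t • q)) := by
  obtain ⟨x, hx, hx'⟩ := hq
  rw [← Measure.addHaar_smul_of_nonneg _ (sub_nonneg.2 ht1), ← measure_vadd μ (t • x)]
  refine measure_mono ?_
  rintro _ ⟨_, ⟨y, ⟨hy, hy'⟩, rfl⟩, rfl⟩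
  constructor
  · convert convex_coneOver hconv hy hx (sub_nonneg.2 ht1) ht0 (by ring) using 1
    ext
    · simp only [Prod.fst_add, Prod.smul_fst, smul_eq_mul]; ring
    · simp [add_comm]
  · convert convex_coneOver hconv hy' hx' (sub_nonneg.2 ht1) ht0 (by ring) using 1
    ext
    · simp only [Prod.fst_add, Prod.smul_fst, smul_eq_mul, Prod.fst_sub]; ring
    · simp only [Prod.snd_add, Prod.smul_snd, Prod.snd_sub, vadd_eq_add]; module

theorem measure_coneSection_eq_of_ae_eq (hK : IsCompact K) (hconv : Convex ℝ K)
    (hint : (interior K).Nonempty) (hd : dim ≠ 0)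
    (h : ∀ᵐ v ∂((volume : Measure ℝ).prod μ),
      ENNReal.ofReal (max ((1 - gauge (coneBall K) v) / 2) 0 ^ dim) * μ K =
        μ (coneSection K v)) {v : ℝ × E} (hv : gauge (coneBall K) v < 1) :
    ENNReal.ofReal (max ((1 - gauge (coneBall K) v) / 2) 0 ^ dim) * μ K =
        μ (coneSection K v) := by
  have hc := continuous_gauge_coneBall hconv hint
  refine le_antisymm (measure_coneSection_ge hK hconv hint hd v) (not_lt.1 fun hlt => ?_)
  have hΦ : Continuous fun v : ℝ × E =>
      ENNReal.ofReal (max ((1 - gauge (coneBall K) v) / 2) 0 ^ dim) * μ K :=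
    ENNReal.continuous_mul_const hK.measure_ne_top |>.comp
      (ENNReal.continuous_ofReal.comp (by fun_prop))
  have hS : Continuous fun t : ℝ => ENNReal.ofReal ((1 - t) ^ dim) * μ (coneSection K v) :=
    ENNReal.continuous_mul_const (isCompact_coneSection hK v).measure_ne_top |>.comp
      (ENNReal.continuous_ofReal.comp (by fun_prop))
  have h1 := (hS.tendsto 0).eventually_const_lt (by simpa only [sub_zero, one_pow, ENNReal.ofReal_one, one_mul] using hlt)
  obtain ⟨t, ht, ht'⟩ := ((h1.filter_mono (nhdsWithin_le_nhds (s := Set.Ioi 0))).and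
    (Ioo_mem_nhdsGT one_pos)).exists
  set U : Set (ℝ × E) := {z | ENNReal.ofReal (max ((1 - gauge (coneBall K) z) / 2) 0 ^ dim) * μ K <
    ENNReal.ofReal ((1 - t) ^ dim) * μ (coneSection K v)} ∩
    {z | gauge (coneBall K) (v + t⁻¹ • (z - v)) < 1} with hU
  have hUo : IsOpen U := (isOpen_lt hΦ continuous_const).inter
    (isOpen_lt (hc.comp (by fun_prop)) continuous_const)
  have hvU : v ∈ U := ⟨ht, by simpa using hv⟩
  refine (hUo.measure_pos ((volume : Measure ℝ).prod μ) ⟨v, hvU⟩).ne' ?_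
  refine measure_mono_null (fun z hz => ?_) h
  obtain ⟨hz1, hz2⟩ := hz
  obtain ⟨a, ha, b, hb, hab, hr⟩ := exists_sub_eq_gauge_coneBall hK hconv hint (v + t⁻¹ • (z - v))
  have hne := (((hint.mono interior_subset).smul_set).vadd_set).mono
    (coneSection_combo_subset hconv ha hb hab hr hz2.le)
  have := le_measure_coneSection_combo (μ := μ) (v := v) hconv hne ht'.1.le ht'.2.le
  rw [smul_add, smul_inv_smul₀ ht'.1.ne', show (1 - t) • v + (t • v + (z - v)) = z by module] at this
  exact (hz1.trans_le this).ne

theorem hasConeSups_of_measure_coneSection_eq (hK : IsCompact K) (hconv : Convex ℝ K)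
    (hint : (interior K).Nonempty)
    (h : ∀ v, gauge (coneBall K) v < 1 →
      ENNReal.ofReal (max ((1 - gauge (coneBall K) v) / 2) 0 ^ dim) * μ K =
        μ (coneSection K v)) : HasConeSups K := by
  obtain ⟨k₀, hk₀⟩ := hint.mono interior_subset
  have hu : ((1 : ℝ), k₀) ∈ coneOver K := by simpa using mk_smul_mem_coneOver zero_le_one hk₀
  intro v
  obtain ⟨a, ha, b, hb, hab, hr⟩ := exists_sub_eq_gauge_coneBall hK hconv hint v
  refine ⟨a, fun p => ⟨fun ⟨hp, hpv⟩ => ?_, fun hp => ⟨?_, ?_⟩⟩⟩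
  · have key : ∀ ε : ℝ, 0 < ε → p + ε • ((1 : ℝ), k₀) - a ∈ coneOver K := by
      intro ε hε
      set q := p + ε • ((1 : ℝ), k₀) with hq
      have hqP : q ∈ coneOver K := add_mem_coneOver hconv hp (smul_mem_coneOver hε.le hu)
      have hqvP : q - v ∈ coneOver K := by
        have := add_mem_coneOver hconv hpv (smul_mem_coneOver hε.le hu)
        rwa [show p - v + ε • ((1 : ℝ), k₀) = q - v by rw [hq]; abel] at this
      have hq1 : q.1 = p.1 + ε := by simp [hq]
      have hN := gauge_coneBall_sub_le hp hpv
      rw [sub_sub_cancel, Prod.fst_sub] at hN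
      have hN0 := gauge_nonneg (s := coneBall K) v
      obtain ⟨L, hL⟩ : ∃ L, L = 2 * q.1 - v.1 := ⟨_, rfl⟩
      have hNL : gauge (coneBall K) v < L := by linarith
      have hL0 : 0 < L := hN0.trans_lt hNL
      have hL0' := inv_nonneg.2 hL0.le
      have hgv : gauge (coneBall K) (L⁻¹ • v) = L⁻¹ * gauge (coneBall K) v :=
        gauge_smul_of_nonneg hL0' v
      have hlt : gauge (coneBall K) (L⁻¹ • v) < 1 := by
        rw [hgv, inv_mul_lt_iff₀ hL0]; linarith
      set r := gauge (coneBall K) (L⁻¹ • v) with hr'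
      have hsub := coneSection_combo_subset hconv (smul_mem_coneOver hL0' ha)
        (smul_mem_coneOver hL0' hb) (by rw [← smul_sub, hab]) (r := r)
        (by rw [hgv, ← hr]; simp [mul_add]) hlt.le
      have hpos : 0 < (1 - r) / 2 := by linarith
      have hcpt : IsCompact ((L⁻¹ • a).2 +ᵥ ((1 - r) / 2) • K) := (hK.smul _).vadd _
      have hint' : (interior (coneSection K (L⁻¹ • v))).Nonempty := by
        refine Set.Nonempty.mono (interior_mono hsub) ?_
        rw [interior_vadd, interior_smul₀ hpos.ne']
        exact hint.smul_set.vadd_set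
      have hsub' := subset_of_measure_le (μ := μ) hcpt.isClosed (convex_coneSection hconv _) hint'
        hsub (by
          rw [← h _ hlt, measure_vadd, Measure.addHaar_smul_of_nonneg _ hpos.le,
            max_eq_left hpos.le]) hcpt.measure_ne_top
      have hh : (1 + (L⁻¹ • v).1) / 2 = L⁻¹ * q.1 := by
        simp only [Prod.smul_fst, smul_eq_mul]
        field_simp
        linarith
      have hmem : L⁻¹ • q.2 ∈ coneSection K (L⁻¹ • v) := by
        have e : ((1 + (L⁻¹ • v).1) / 2, L⁻¹ • q.2) = L⁻¹ • q := Prod.ext hh rfl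
        refine ⟨?_, ?_⟩
        · rw [e]; exact smul_mem_coneOver hL0' hqP
        · rw [e, ← smul_sub]; exact smul_mem_coneOver hL0' hqvP
      obtain ⟨y, hy, hye⟩ := hsub' hmem
      rw [← smul_mem_coneOver_iff (inv_pos.2 hL0)]
      have e1 : (L⁻¹ • (q - a)).1 = (1 - r) / 2 := by
        have hv1 : v.1 = a.1 - b.1 := by rw [← hab]; rfl
        rw [hgv, ← hr]
        simp only [Prod.smul_fst, Prod.fst_sub, smul_eq_mul]
        field_simp
        linarith
      have e2 : (L⁻¹ • (q - a)).2 = y := by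
        simp only [vadd_eq_add, Prod.smul_snd] at hye
        simp only [Prod.smul_snd, Prod.snd_sub, smul_sub, ← hye]
        abel
      refine ⟨by rw [e1]; exact hpos.le, ?_⟩
      rw [e1, e2]
      exact hy
    have hlim : Filter.Tendsto (fun ε : ℝ => p + ε • ((1 : ℝ), k₀) - a) (nhdsWithin 0 (Set.Ioi 0))
        (nhds (p - a)) :=
      (Continuous.tendsto' (by fun_prop) _ _ (by simp)).mono_left nhdsWithin_le_nhds
    exact (isClosed_coneOver hK).mem_of_tendsto hlim
      (Filter.eventually_of_mem self_mem_nhdsWithin key)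
  · simpa using add_mem_coneOver hconv hp ha
  · have := add_mem_coneOver hconv hp hb
    rwa [show p - a + b = p - v by rw [← hab]; abel] at this

theorem measure_coneSection_eq_of_hasConeSups (hK : IsCompact K) (hconv : Convex ℝ K)
    (hint : (interior K).Nonempty) (hd : dim ≠ 0) (hS : HasConeSups K) (v : ℝ × E) :
    ENNReal.ofReal (max ((1 - gauge (coneBall K) v) / 2) 0 ^ dim) * μ K =
        μ (coneSection K v) := by
  refine le_antisymm (measure_coneSection_ge hK hconv hint hd v) ?_
  obtain ⟨w, hw⟩ := hS v
  obtain ⟨h1, h2⟩ := (hw w).2 (by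
    rw [sub_self]; exact zero_mem_coneOver (hint.mono interior_subset))
  have hN := gauge_coneBall_sub_le h1 h2
  rw [sub_sub_cancel, Prod.fst_sub] at hN
  have hsub : coneSection K v ⊆ {y | ((1 + v.1) / 2, y) - w ∈ coneOver K} :=
    fun y hy => (hw _).1 hy
  rcases lt_or_ge ((1 + v.1) / 2 - w.1) 0 with hneg | hpos
  · have : coneSection K v = ∅ := by
      refine Set.eq_empty_of_forall_notMem fun y hy => ?_
      have := (hsub hy).1
      rw [Prod.fst_sub] at this
      exact hneg.not_ge this
    rw [this]
    simp
  · have hsub' : coneSection K v ⊆ w.2 +ᵥ ((1 + v.1) / 2 - w.1) • K := by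
      intro y hy
      exact ⟨y - w.2, (hsub hy).2, by simp⟩
    refine (measure_mono hsub').trans ?_
    rw [measure_vadd, Measure.addHaar_smul_of_nonneg _ hpos]
    gcongr
    refine le_max_of_le_left ?_
    linarith

theorem integral_combo_neg_eq_iff_hasConeSups (hK : IsCompact K) (hconv : Convex ℝ K)
    (hint : (interior K).Nonempty) (hd : dim ≠ 0) :
    ∫ t in (0 : ℝ)..1, (μ ((1 - t) • K + t • (-K))).toReal =
      2 ^ dim / (dim + 1) * (μ K).toReal ↔ HasConeSups K := by
  rw [integral_combo_neg_eq_iff hK hconv hint hd]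
  exact ⟨fun h => hasConeSups_of_measure_coneSection_eq hK hconv hint fun v hv =>
    measure_coneSection_eq_of_ae_eq hK hconv hint hd h hv,
    fun h => ae_of_all _ (measure_coneSection_eq_of_hasConeSups hK hconv hint hd h)⟩

end

section Simplex
variable {E : Type*} [AddCommGroup E] [Module ℝ E] {K : Set E}

theorem sum_mem_coneOver (hconv : Convex ℝ K) (hne : K.Nonempty) {ι : Type*} (s : Finset ι)
    {p : ι → ℝ × E} (hp : ∀ i ∈ s, p i ∈ coneOver K) : ∑ i ∈ s, p i ∈ coneOver K :=
  Finset.sum_induction _ (· ∈ coneOver K) (fun _ _ => add_mem_coneOver hconv)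
    (zero_mem_coneOver hne) hp

theorem one_mk_mem_coneOver {k : E} (hk : k ∈ K) : ((1 : ℝ), k) ∈ coneOver K := by
  simpa using mk_smul_mem_coneOver zero_le_one hk

theorem AffineIndependent.linearIndependent_one_mk {ι : Type*} {f : ι → E}
    (hf : AffineIndependent ℝ f) : LinearIndependent ℝ fun i => ((1 : ℝ), f i) := by
  rw [linearIndependent_iff']
  intro s g hg
  refine affineIndependent_iff.1 hf s g ?_ ?_
  · simpa [Prod.fst_sum] using congrArg Prod.fst hg
  · simpa [Prod.snd_sum] using congrArg Prod.snd hg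

theorem mem_coneOver_convexHull_range_iff {ι : Type*} [Fintype ι] [Nonempty ι] {f : ι → E}
    (b : Module.Basis ι ℝ (ℝ × E)) (hb : ∀ i, b i = (1, f i)) {p : ℝ × E} :
    p ∈ coneOver (convexHull ℝ (Set.range f)) ↔ ∀ i, 0 ≤ b.repr p i := by
  constructor
  · intro hp
    obtain ⟨k, hk, hpk⟩ := exists_of_mem_coneOver hp
    have hsub : convexHull ℝ (Set.range f) ⊆ {k | ∀ i, 0 ≤ b.repr (1, k) i} := by
      refine convexHull_min ?_ ?_
      · rintro _ ⟨j, rfl⟩ i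
        rw [← hb, b.repr_self]
        classical
        rw [Finsupp.single_apply]
        split_ifs <;> norm_num
      · intro x hx y hy s t hs ht hst i
        have : ((1 : ℝ), s • x + t • y) = s • (1, x) + t • (1, y) := by
          simp [hst]
        rw [this, map_add, map_smul, map_smul]
        exact add_nonneg (mul_nonneg hs (hx i)) (mul_nonneg ht (hy i))
    intro i
    have : p = p.1 • ((1 : ℝ), k) := by rw [hpk]; simp
    rw [this, map_smul]
    exact mul_nonneg hp.1 (hsub hk i)
  · intro h
    rw [← b.sum_repr p]
    refine sum_mem_coneOver (convex_convexHull ℝ _)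
      ((Set.range_nonempty f).mono (subset_convexHull ℝ _)) _ fun i _ => ?_
    rw [hb]
    exact smul_mem_coneOver (h i)
      (one_mk_mem_coneOver (subset_convexHull ℝ _ (Set.mem_range_self i)))

theorem hasConeSups_convexHull_range [FiniteDimensional ℝ E] {f : Fin (Module.finrank ℝ E + 1) → E}
    (hf : AffineIndependent ℝ f) : HasConeSups (convexHull ℝ (Set.range f)) := by
  let b : Module.Basis (Fin (Module.finrank ℝ E + 1)) ℝ (ℝ × E) :=
    basisOfLinearIndependentOfCardEqFinrank hf.linearIndependent_one_mk (by simp [add_comm])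
  have hb : ∀ i, b i = (1, f i) := fun i => by
    simp [b]
  intro v
  refine ⟨∑ i, max 0 (b.repr v i) • b i, fun p => ?_⟩
  simp only [mem_coneOver_convexHull_range_iff b hb, map_sub, Finsupp.sub_apply,
    b.repr_sum_self, sub_nonneg, max_le_iff, forall_and]

theorem eq_smul_of_mem_extremePoints {e : E} (he : e ∈ K.extremePoints ℝ)
    {c : ℝ} {p : ℝ × E} (hp : p ∈ coneOver K) (hpc : c • ((1 : ℝ), e) - p ∈ coneOver K) :
    p = p.1 • ((1 : ℝ), e) := by
  obtain ⟨k, hk, hpk⟩ := exists_of_mem_coneOver hp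
  obtain ⟨l, hl, hql⟩ := exists_of_mem_coneOver hpc
  rcases hp.1.eq_or_lt with h0 | h0
  · rw [eq_zero_of_mem_coneOver hp h0.ge]; simp
  rcases hpc.1.eq_or_lt with h1 | h1
  · have h2 := eq_zero_of_mem_coneOver hpc h1.ge
    rw [sub_eq_zero] at h2
    rw [← h2]
    simp
  set s := p.1 with hs
  set q := c • ((1 : ℝ), e) - p with hq
  have hc : c = s + q.1 := by simp [hq, hs]
  have hc0 : 0 < c := by rw [hc]; exact add_pos h0 h1
  have h2 : s • k + q.1 • l = c • e := by
    have : p.2 + q.2 = c • e := by simp [hq]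
    rw [← this]
    rw [congrArg Prod.snd hpk, congrArg Prod.snd hql]
  have hke : k = e := by
    refine he.2 hk hl ⟨s / c, q.1 / c, by positivity, by positivity, ?_, ?_⟩
    · rw [← add_div, ← hc, div_self hc0.ne']
    · rw [div_eq_inv_mul, div_eq_inv_mul, mul_smul, mul_smul, ← smul_add, h2,
        inv_smul_smul₀ hc0.ne']
  rw [hpk, hke]
  simp

theorem HasConeSups.exists_add_of_le_add (hS : HasConeSups K) {x a b : ℝ × E}
    (hx : x ∈ coneOver K) (ha : a ∈ coneOver K) (hb : b ∈ coneOver K)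
    (h : a + b - x ∈ coneOver K) :
    ∃ y ∈ coneOver K, ∃ z ∈ coneOver K, x = y + z ∧ a - y ∈ coneOver K ∧ b - z ∈ coneOver K := by
  obtain ⟨w, hw⟩ := hS (x - a)
  have hww := hw w
  obtain ⟨h1, h2⟩ := hww.2 (by
    rw [sub_self]
    obtain ⟨k, hk, -⟩ := exists_of_mem_coneOver hx
    exact zero_mem_coneOver ⟨k, hk⟩)
  refine ⟨x - w, (hw x).1 ⟨hx, by rwa [sub_sub_cancel]⟩, w, h1, by abel, ?_,
    (hw b).1 ⟨hb, by rwa [show b - (x - a) = a + b - x by abel]⟩⟩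
  rwa [show a - (x - w) = w - (x - a) by abel]

theorem HasConeSups.eq_zero_of_smul_le_sum (hS : HasConeSups K) (hconv : Convex ℝ K) {e : E}
    (he : e ∈ K.extremePoints ℝ) {ι : Type*} {f : ι → E} (s : Finset ι)
    (hf : ∀ i ∈ s, f i ∈ K.extremePoints ℝ ∧ f i ≠ e) {w : ι → ℝ} (hw : ∀ i ∈ s, 0 ≤ w i) {c : ℝ}
    (hc : 0 ≤ c) (h : ∑ i ∈ s, w i • ((1 : ℝ), f i) - c • ((1 : ℝ), e) ∈ coneOver K) : c = 0 := by
  classical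
  induction s using Finset.induction_on with
  | empty =>
    have := h.1
    simp at this
    exact le_antisymm this hc
  | insert j s hj ih =>
    rw [Finset.sum_insert hj] at h
    have hfj := hf j (Finset.mem_insert_self _ _)
    obtain ⟨y, hy, z, hz, hyz, hy', hz'⟩ := hS.exists_add_of_le_add
      (smul_mem_coneOver hc (one_mk_mem_coneOver he.1))
      (smul_mem_coneOver (hw j (Finset.mem_insert_self _ _)) (one_mk_mem_coneOver hfj.1.1))
      (sum_mem_coneOver hconv ⟨e, he.1⟩ s fun i hi => smul_mem_coneOver
        (hw i (Finset.mem_insert_of_mem hi))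
        (one_mk_mem_coneOver (hf i (Finset.mem_insert_of_mem hi)).1.1)) h
    have h1 := eq_smul_of_mem_extremePoints hfj.1 hy hy'
    have h2 := eq_smul_of_mem_extremePoints he hy (c := c) (by rw [hyz]; simpa using hz)
    have hy0 : y.1 = 0 := by
      by_contra hne
      rw [h1] at h2
      have := congrArg Prod.snd h2
      simp only [Prod.smul_snd, Prod.smul_fst, smul_eq_mul, mul_one] at this
      exact hfj.2 (smul_right_injective E hne this)
    have hy00 : y = 0 := by rw [h1, hy0, zero_smul]
    rw [hy00, zero_add] at hyz
    refine ih (fun i hi => hf i (Finset.mem_insert_of_mem hi))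
      (fun i hi => hw i (Finset.mem_insert_of_mem hi)) ?_
    rwa [hyz]

theorem HasConeSups.affineIndependent_extremePoints (hS : HasConeSups K) (hconv : Convex ℝ K) :
    AffineIndependent ℝ ((↑) : K.extremePoints ℝ → E) := by
  classical
  have key : ∀ (s : Finset (K.extremePoints ℝ)) (w : K.extremePoints ℝ → ℝ), s.sum w = 0 →
      ∑ e ∈ s, w e • (e : E) = 0 → ∀ e ∈ s, w e ≤ 0 := by
    intro s w hw0 hw1 e he
    by_contra! hpos
    have hsum : ∑ i ∈ s, w i • ((1 : ℝ), (i : E)) = 0 := by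
      ext
      · simpa [Prod.fst_sum] using hw0
      · simpa [Prod.snd_sum] using hw1
    refine hpos.ne' (hS.eq_zero_of_smul_le_sum hconv e.2 (f := ((↑) : K.extremePoints ℝ → E))
      (s.erase e) (fun i hi => ⟨i.2, fun h => Finset.ne_of_mem_erase hi (Subtype.ext h)⟩)
      (w := fun i => max (-w i) 0) (fun _ _ => le_max_right _ _) hpos.le ?_)
    have : ∑ i ∈ s.erase e, max (-w i) 0 • ((1 : ℝ), (i : E)) - w e • ((1 : ℝ), (e : E)) =
        ∑ i ∈ s.erase e, (max (-w i) 0 + w i) • ((1 : ℝ), (i : E)) := by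
      rw [← Finset.add_sum_erase s _ he, add_eq_zero_iff_eq_neg] at hsum
      rw [hsum, sub_neg_eq_add, ← Finset.sum_add_distrib]
      exact Finset.sum_congr rfl fun i _ => (add_smul _ _ _).symm
    rw [this]
    exact sum_mem_coneOver hconv ⟨e, e.2.1⟩ _ fun i _ => smul_mem_coneOver
      (by linarith [le_max_left (-w i) 0]) (one_mk_mem_coneOver i.2.1)
  rw [affineIndependent_iff]
  intro s w hw0 hw1 e he
  refine le_antisymm (key s w hw0 hw1 e he) ?_
  have := key s (-w) (by simp [hw0]) (by simp [hw1]) e he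
  simpa using this

end Simplex

theorem HasConeSups.exists_eq_convexHull_range {E : Type*} [NormedAddCommGroup E]
    [NormedSpace ℝ E] [FiniteDimensional ℝ E] {K : Set E} (hS : HasConeSups K) (hK : IsCompact K)
    (hconv : Convex ℝ K) (hint : (interior K).Nonempty) :
    ∃ f : Fin (Module.finrank ℝ E + 1) → E,
      AffineIndependent ℝ f ∧ K = convexHull ℝ (Set.range f) := by
  have hAI := hS.affineIndependent_extremePoints hconv
  have hfin : Finite (K.extremePoints ℝ) := finite_of_fin_dim_affineIndependent ℝ hAI
  have hKE : K = convexHull ℝ (K.extremePoints ℝ) := by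
    conv_lhs => rw [← closure_convexHull_extremePoints hK hconv]
    exact ((Set.toFinite (K.extremePoints ℝ)).isClosed_convexHull (𝕜 := ℝ)).closure_eq
  cases nonempty_fintype (K.extremePoints ℝ)
  have hcard : Fintype.card (K.extremePoints ℝ) = Module.finrank ℝ E + 1 := by
    rw [← hAI.affineSpan_eq_top_iff_card_eq_finrank_add_one, Subtype.range_coe]
    rwa [← interior_convexHull_nonempty_iff_affineSpan_eq_top, ← hKE]
  let g := (Fintype.equivFinOfCardEq hcard).symm
  refine ⟨fun i => g i, hAI.comp_embedding g.toEmbedding, ?_⟩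
  have hr : Set.range (fun i => (g i : E)) = K.extremePoints ℝ := by
    change Set.range (((↑) : K.extremePoints ℝ → E) ∘ g) = _
    rw [g.surjective.range_comp, Subtype.range_coe]
  rwa [hr]

theorem hasConeSups_iff_exists_eq_convexHull_range {E : Type*} [NormedAddCommGroup E]
    [NormedSpace ℝ E] [FiniteDimensional ℝ E] {K : Set E} (hK : IsCompact K)
    (hconv : Convex ℝ K) (hint : (interior K).Nonempty) :
    HasConeSups K ↔ ∃ f : Fin (Module.finrank ℝ E + 1) → E,
      AffineIndependent ℝ f ∧ K = convexHull ℝ (Set.range f) := by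
  refine ⟨fun h => h.exists_eq_convexHull_range hK hconv hint, ?_⟩
  rintro ⟨f, hf, rfl⟩
  exact hasConeSups_convexHull_range hf

section
variable {n : ℕ} {K : Set (EuclideanSpace ℝ (Fin n))}

theorem volume_toReal_le_combo_neg (hK : IsCompact K) (hne : K.Nonempty) {t : ℝ}
    (ht : t ∈ Set.Icc (0 : ℝ) 1) :
    (volume K).toReal ≤ (volume ((1 - t) • K + t • (-K))).toReal :=
  ENNReal.toReal_mono (isCompact_combo_neg hK t).measure_ne_top
    ((prekopaLeindler_euclideanSpace n).measure_le_measure_combo_neg hK hne ht)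

theorem volume_le_integral_combo_neg (hK : IsCompact K) (hne : K.Nonempty) :
    (volume K).toReal ≤ ∫ t in (0 : ℝ)..1, (volume ((1 - t) • K + t • (-K))).toReal := by
  have := intervalIntegral.integral_mono_on zero_le_one
    (intervalIntegrable_const (c := (volume K).toReal)) (intervalIntegrable_combo_neg hK)
    fun t ht => volume_toReal_le_combo_neg hK hne ht
  simpa using this

theorem volume_eq_integral_combo_neg_iff (hK : IsCompact K) (hconv : Convex ℝ K)
    (hint : (interior K).Nonempty) :
    (volume K).toReal = ∫ t in (0 : ℝ)..1, (volume ((1 - t) • K + t • (-K))).toReal ↔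
      ∃ c : EuclideanSpace ℝ (Fin n), ∀ x, x ∈ K ↔ c + c - x ∈ K := by
  have hne := hint.mono interior_subset
  constructor
  · intro h
    refine exists_center_of_volume_midpoint_eq hK hconv hint (le_antisymm ?_
      ((prekopaLeindler_euclideanSpace n).measure_le_measure_combo_neg hK hne
        ⟨by norm_num, by norm_num⟩))
    by_contra! hlt
    set M := volume ((1 - 1 / 2 : ℝ) • K + (1 / 2 : ℝ) • (-K)) with hM
    have hMfin : M ≠ ∞ := (isCompact_combo_neg hK _).measure_ne_top
    have hc : Continuous fun t : ℝ => ENNReal.ofReal ((2 * t) ^ n) * M :=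
      ENNReal.continuous_mul_const hMfin |>.comp (ENNReal.continuous_ofReal.comp (by fun_prop))
    have hev := (hc.tendsto (1 / 2)).eventually_const_lt (u := volume K) (by
      simpa using hlt)
    obtain ⟨a, ha, ha'⟩ := Metric.eventually_nhds_iff.1 hev
    have hb : 0 < min a (1 / 2) := lt_min ha (by norm_num)
    have hsub : Set.Ioo (1 / 2 - min a (1 / 2)) (1 / 2) ⊆
        {t | (volume K).toReal < (volume ((1 - t) • K + t • (-K))).toReal} := by
      intro t ht
      have h1 : dist t (1 / 2) < a := by
        rw [Real.dist_eq, abs_lt]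
        constructor <;> linarith [ht.1, ht.2, min_le_left a (1 / 2)]
      have h2 := measure_half_combo_neg_le (μ := volume) hconv hne (t := t)
        (by linarith [ht.1, min_le_right a (1 / 2)]) ht.2.le
      rw [finrank_euclideanSpace_fin] at h2
      exact ENNReal.toReal_strict_mono (isCompact_combo_neg hK t).measure_ne_top
        ((ha' h1).trans_le h2)
    refine (intervalIntegral.integral_lt_integral_of_ae_le_of_measure_setOfPred_lt_ne_zero
      zero_le_one (intervalIntegrable_const (c := (volume K).toReal))
      (intervalIntegrable_combo_neg hK) ?_ ?_).ne (by simpa using h)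
    · exact (ae_restrict_iff' measurableSet_Ioc).2 (ae_of_all _ fun t ht =>
        volume_toReal_le_combo_neg hK hne ⟨ht.1.le, ht.2⟩)
    · refine ((measure_pos_of_superset hsub ?_)).ne'
      rw [Measure.restrict_apply measurableSet_Ioo, Set.inter_eq_left.2, Real.volume_Ioo]
      · simpa using hb
      · exact fun t ht => ⟨by linarith [ht.1, min_le_right a (1 / 2)], by linarith [ht.2]⟩
  · rintro ⟨c, hc⟩
    rw [intervalIntegral.integral_congr (g := fun _ => (volume K).toReal)]
    · simp
    · intro t ht
      rw [Set.uIcc_of_le zero_le_one] at ht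
      simp only [volume_combo_neg_of_center hconv hc ht]

end

theorem rogers_shephard_integral {n : ℕ} (K : Set (EuclideanSpace ℝ (Fin n)))
    (hKc : IsCompact K) (hKconv : Convex ℝ K) (hKint : (interior K).Nonempty) :
    ((volume K).toReal ≤ ∫ t in (0:ℝ)..1, (volume ((1 - t) • K + t • (-K))).toReal) ∧
    (∫ t in (0:ℝ)..1, (volume ((1 - t) • K + t • (-K))).toReal ≤
      2 ^ n / (n + 1 : ℝ) * (volume K).toReal) ∧
    ((volume K).toReal = ∫ t in (0:ℝ)..1, (volume ((1 - t) • K + t • (-K))).toReal ↔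
      ∃ c : EuclideanSpace ℝ (Fin n), ∀ x, x ∈ K ↔ c + c - x ∈ K) ∧
    (∫ t in (0:ℝ)..1, (volume ((1 - t) • K + t • (-K))).toReal =
        2 ^ n / (n + 1 : ℝ) * (volume K).toReal ↔
      ∃ f : Fin (n + 1) → EuclideanSpace ℝ (Fin n),
        AffineIndependent ℝ f ∧ K = convexHull ℝ (Set.range f)) := by
  have hne := hKint.mono interior_subset
  refine ⟨volume_le_integral_combo_neg hKc hne, ?_⟩
  rw [and_left_comm]
  refine ⟨volume_eq_integral_combo_neg_iff hKc hKconv hKint, ?_⟩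
  rcases eq_or_ne n 0 with rfl | hn
  · have h : ∀ t : ℝ, (1 - t) • K + t • (-K) = K := fun t => by
      exact (Subsingleton.eq_univ_of_nonempty (hne.smul_set.add hne.neg.smul_set)).trans
        (Subsingleton.eq_univ_of_nonempty hne).symm
    simp only [h]
    have : Subsingleton (Fin (0 + 1)) := inferInstanceAs (Subsingleton (Fin 1))
    refine ⟨by simp, iff_of_true (by simp) ⟨fun _ => 0, affineIndependent_of_subsingleton ℝ _, ?_⟩⟩
    exact (Subsingleton.eq_univ_of_nonempty hne).trans (Subsingleton.eq_univ_of_nonempty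
      ((Set.range_nonempty _).mono (subset_convexHull ℝ _))).symm
  · have hd := finrank_euclideanSpace_fin (𝕜 := ℝ) (n := n)
    have h1 := integral_combo_neg_le (μ := volume) hKc hKconv hKint (hd.trans_ne hn)
    have h2 := (integral_combo_neg_eq_iff_hasConeSups (μ := volume) hKc hKconv hKint
      (hd.trans_ne hn)).trans (hasConeSups_iff_exists_eq_convexHull_range hKc hKconv hKint)
    rw [hd] at h1 h2
    exact ⟨h1, h2⟩
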